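/- arXiv:1102.1681 — 2 statements merged into one kernel-verified Lean document; each statement's English description precedes it below -/
import Mathlib

section
/- Let τ > ω be a cardinal and let h : Z → F be a homeomorphism between C-embedded Z_τ-sets Z and F in ℝ^τ. Then there is a homeomorphism H : ℝ^τ → ℝ^τ such that H|Z = h. -/
open Set Topology

universe u

/-- A subset `U` of a topological space is functionally open (a cozero set). -/
def FunctionallyOpen {X : Type*} [TopologicalSpace X] (U : Set X) : Prop :=
  ∃ φ : X → ℝ, Continuous φ ∧ U = φ ⁻¹' {(0 : ℝ)}ᶜ

/-- A countable cover by functionally open sets. -/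
def IsCFOCover {X : Type*} [TopologicalSpace X] (𝒰 : Set (Set X)) : Prop :=
  𝒰.Countable ∧ (∀ U ∈ 𝒰, FunctionallyOpen U) ∧ ⋃₀ 𝒰 = Set.univ

/-- Two maps are `𝒰`-close if every point's images lie in a common member of `𝒰`. -/
def UClose {X Y : Type*} (𝒰 : Set (Set Y)) (f g : X → Y) : Prop :=
  ∀ x, ∃ U ∈ 𝒰, f x ∈ U ∧ g x ∈ U

/-- Two sets are functionally separated if some continuous `[0,1]`-valued function
is `0` on the first and `1` on the second. -/
def FunctionallySeparated {X : Type*} [TopologicalSpace X] (P Q : Set X) : Prop :=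
  ∃ φ : X → ℝ, Continuous φ ∧ (∀ x, φ x ∈ Set.Icc (0 : ℝ) 1) ∧
    (∀ p ∈ P, φ p = 0) ∧ (∀ q ∈ Q, φ q = 1)

/-- `Z` is a `Z_τ`-set in `X`: the self-maps of `X` whose image is functionally separated
from `Z` are dense in the `τ`-limitation topology on `C(X, X)`. -/
def ZTauSet {X : Type u} [TopologicalSpace X] (τ : Cardinal.{u}) (Z : Set X) : Prop :=
  IsClosed Z ∧ ∀ g : X → X, Continuous g →
    ∀ 𝒞 : Set (Set (Set X)), Cardinal.mk ↥𝒞 < τ → (∀ 𝒰 ∈ 𝒞, IsCFOCover 𝒰) →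
      ∃ f : X → X, Continuous f ∧ (∀ 𝒰 ∈ 𝒞, UClose 𝒰 f g) ∧
        FunctionallySeparated (Set.range f) Z

/-- A subset is C-embedded if every continuous real-valued function on it extends
continuously to the whole space. -/
def CEmbedded {X : Type*} [TopologicalSpace X] (Z : Set X) : Prop :=
  ∀ φ : ↥Z → ℝ, Continuous φ → ∃ ψ : X → ℝ, Continuous ψ ∧ ∀ z : ↥Z, ψ (z : X) = φ z

theorem exists_countable_dependsOn_at {A : Type*} {φ : (A → ℝ) → ℝ} (hφ : Continuous φ)
    (x : A → ℝ) : ∃ S : Set A, S.Countable ∧ ∀ y, (∀ a ∈ S, y a = x a) → φ y = φ x := by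
  have key : ∀ n : ℕ, ∃ I : Finset A, ∀ y, (∀ a ∈ I, y a = x a) →
      φ y ∈ Metric.ball (φ x) (1 / ((n : ℝ) + 1)) := by
    intro n
    have ho : IsOpen (φ ⁻¹' Metric.ball (φ x) (1 / ((n : ℝ) + 1))) :=
      Metric.isOpen_ball.preimage hφ
    obtain ⟨I, u, hu, hsub⟩ := isOpen_pi_iff.1 ho x (Metric.mem_ball_self (by positivity))
    refine ⟨I, fun y hy => hsub fun a ha => ?_⟩
    rw [hy a ha]
    exact (hu a ha).2
  choose I hI using key
  refine ⟨⋃ n, (I n : Set A), countable_iUnion fun n => (I n).countable_toSet, fun y hy => ?_⟩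
  refine dist_le_zero.1 (le_of_forall_pos_lt_add fun ε hε => ?_)
  obtain ⟨n, hn⟩ := exists_nat_one_div_lt hε
  have := hI n y fun a ha => hy a (mem_iUnion.2 ⟨n, ha⟩)
  rw [Metric.mem_ball] at this
  linarith

/-- A continuous real function on a power of the line depends on countably many coordinates. -/
theorem Continuous.exists_countable_dependsOn {A : Type*} {φ : (A → ℝ) → ℝ} (hφ : Continuous φ) :
    ∃ D : Set A, D.Countable ∧ DependsOn φ D := by
  classical
  choose S hSc hS using exists_countable_dependsOn_at hφ
  let pt : (D : Set A) → (D →₀ ℚ) → A → ℝ := fun D q a => if h : a ∈ D then (q ⟨a, h⟩ : ℝ) else 0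
  let D : ℕ → Set A := fun n => 
    Nat.rec (motive := fun _ => Set A) ∅ (fun _ E => E ∪ ⋃ q : ↥E →₀ ℚ, S (pt E q)) n
  have hDs : ∀ n, D (n + 1) = D n ∪ ⋃ q : ↥(D n) →₀ ℚ, S (pt (D n) q) := fun n => rfl
  have hDc : ∀ n, (D n).Countable := by
    intro n
    induction n with
    | zero => exact countable_empty
    | succ n ih =>
      rw [hDs]
      have := ih.to_subtype
      exact ih.union (countable_iUnion fun q => hSc _)
  have hDm : Monotone D := monotone_nat_of_le_succ fun n => by rw [hDs]; exact subset_union_left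
  let E : Set A := ⋃ n, D n
  refine ⟨E, countable_iUnion hDc, ?_⟩
  let res : (A → ℝ) → A → ℝ := fun x a => if a ∈ E then x a else 0
  have hres : Continuous res := by
    refine continuous_pi fun a => ?_
    by_cases h : a ∈ E
    · simpa [res, h] using continuous_apply a
    · simpa [res, h] using continuous_const
  have hdense : Dense {x : A → ℝ | ∃ n, ∃ q : D n →₀ ℚ, ∀ a ∈ E, x a = pt (D n) q a} := by
    rw [dense_iff_inter_open]
    rintro U hU ⟨x, hx⟩
    obtain ⟨I, u, hu, hsub⟩ := isOpen_pi_iff.1 hU x hx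
    have hn : ∃ n, ∀ a ∈ I, a ∈ E → a ∈ D n := by
      have : ∀ a : A, ∃ n, a ∈ E → a ∈ D n := by
        intro a
        by_cases h : a ∈ E
        · obtain ⟨n, hn⟩ := mem_iUnion.1 h
          exact ⟨n, fun _ => hn⟩
        · exact ⟨0, fun h' => absurd h' h⟩
      choose N hN using this
      exact ⟨I.sup N, fun a ha h => hDm (Finset.le_sup ha) (hN a h)⟩
    obtain ⟨n, hn⟩ := hn
    have hr : ∀ a : A, ∃ r : ℚ, a ∈ I → (r : ℝ) ∈ u a := by
      intro a
      by_cases h : a ∈ I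
      · obtain ⟨y, hy, r, hr⟩ := Rat.isDenseEmbedding_coe_real.dense.inter_open_nonempty _
          (hu a h).1 ⟨_, (hu a h).2⟩
        exact ⟨r, fun _ => by rw [hr]; exact hy⟩
      · exact ⟨0, fun h' => absurd h' h⟩
    choose r hr using hr
    let q : D n →₀ ℚ := Finsupp.onFinset (I.subtype (· ∈ D n))
      (fun a => if (a : A) ∈ I then r a else 0) (by
        intro a ha
        rw [Finset.mem_subtype]
        by_contra h
        simp [h] at ha)
    refine ⟨fun a => if a ∈ E then pt (D n) q a else x a, hsub fun a ha => ?_, n, q,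
      fun a ha => if_pos ha⟩
    have ha' : a ∈ I := ha
    by_cases h : a ∈ E
    · have h2 : a ∈ D n := hn a ha' h
      simpa [h, pt, h2, q, ha'] using hr a ha'
    · simpa [h] using (hu a ha').2
  have heq : φ = φ ∘ res := by
    refine hφ.ext_on hdense (hφ.comp hres) ?_
    rintro x ⟨n, q, hx⟩
    have hsub : S (pt (D n) q) ⊆ E := fun a ha =>
      mem_iUnion.2 ⟨n + 1, by rw [hDs]; exact Or.inr (mem_iUnion.2 ⟨q, ha⟩)⟩
    rw [Function.comp_apply, hS (pt (D n) q) x fun a ha => hx a (hsub ha),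
      hS (pt (D n) q) (res x) fun a ha => ?_]
    rw [← hx a (hsub ha)]
    exact if_pos (hsub ha)
  intro x y hxy
  rw [heq, Function.comp_apply, Function.comp_apply]
  congr 1
  funext a
  by_cases h : a ∈ E
  · simp [res, h, hxy a h]
  · simp [res, h]

theorem isCFOCover_coordinate {A : Type*} (b : A) (n : ℕ) :
    IsCFOCover (range fun q : ℚ => {x : A → ℝ | |x b - q| < 1 / ((n : ℝ) + 1)}) := by
  refine ⟨countable_range _, ?_, ?_⟩
  · rintro _ ⟨q, rfl⟩
    refine ⟨fun x => max 0 (1 / ((n : ℝ) + 1) - |x b - q|), by fun_prop, ?_⟩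
    ext x
    simp only [mem_ofPred_eq, mem_preimage, mem_compl_iff, mem_singleton_iff]
    rw [← sub_pos]
    constructor
    · intro h
      rw [max_eq_right h.le]
      exact h.ne'
    · intro h
      by_contra h'
      exact h (max_eq_left (not_lt.1 h'))
  · refine eq_univ_of_forall fun x => ?_
    obtain ⟨q, hq⟩ := exists_rat_near (x b) (show 0 < 1 / ((n : ℝ) + 1) by positivity)
    exact ⟨_, ⟨q, rfl⟩, hq⟩

/-- For a `Z_τ`-set the identity of the power can be pushed off it without changing fewer than
`τ` given coordinates. -/
theorem ZTauSet.exists_push {A : Type u} {τ : Cardinal.{u}} (hτ : Cardinal.aleph0 < τ)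
    {Z : Set (A → ℝ)} (hZ : ZTauSet τ Z) {B : Set A} (hB : Cardinal.mk B < τ) :
    ∃ f : (A → ℝ) → A → ℝ, Continuous f ∧ (∀ x, ∀ b ∈ B, f x b = x b) ∧
      FunctionallySeparated (range f) Z := by
  let cov : B × ℕ → Set (Set (A → ℝ)) := fun p =>
    range fun q : ℚ => {x : A → ℝ | |x p.1 - q| < 1 / ((p.2 : ℝ) + 1)}
  have hcard : Cardinal.mk (range cov) < τ := by
    refine Cardinal.mk_range_le.trans_lt ?_
    rw [Cardinal.mk_prod, Cardinal.lift_uzero, Cardinal.mk_nat, Cardinal.lift_aleph0]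
    exact Cardinal.mul_lt_of_lt hτ.le hB hτ
  obtain ⟨f, hf, hclose, hsep⟩ := hZ.2 id continuous_id (range cov) hcard (by
    rintro _ ⟨p, rfl⟩
    exact isCFOCover_coordinate _ _)
  refine ⟨f, hf, fun x b hb => ?_, hsep⟩
  refine eq_of_forall_dist_le fun ε hε => ?_
  rw [Real.dist_eq]
  obtain ⟨n, hn⟩ := exists_nat_one_div_lt (half_pos hε)
  obtain ⟨_, ⟨q, rfl⟩, h1, h2⟩ := hclose _ ⟨(⟨b, hb⟩, n), rfl⟩ x
  simp only [mem_ofPred_eq, id] at h1 h2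
  rw [abs_lt] at h1 h2
  rw [abs_le]
  constructor <;> linarith [h1.1, h1.2, h2.1, h2.2]

/-- A section `e` over the coordinates in `B` together with a function `ρ` that equals `1` on the
section, vanishes on the given `Z_τ`-set and is antitone along rays issuing from the section. -/
theorem ZTauSet.exists_section {A : Type u} {τ : Cardinal.{u}} (hτ : Cardinal.aleph0 < τ)
    (hA : Cardinal.mk A = τ) {Z : Set (A → ℝ)} (hZ : ZTauSet τ Z) {B : Set A}
    (hB : Cardinal.mk B < τ) :
    ∃ (e : (A → ℝ) → A → ℝ) (ρ : (A → ℝ) → ℝ) (D : Set A) (w : A),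
      (D.Countable ∧ w ∉ B ∧ w ∉ D) ∧ Continuous e ∧ Continuous ρ ∧ DependsOn e B ∧
      (∀ x, ∀ b ∈ B, e x b = x b) ∧ DependsOn ρ (B ∪ D) ∧ (∀ x, 0 ≤ ρ x) ∧ (∀ x, ρ x ≤ 1) ∧
      (∀ z ∈ Z, ρ z = 0) ∧ (∀ x, ρ (e x) = 1) ∧
      ∀ x (r s : ℝ), 0 ≤ r → r ≤ s → ρ (e x + s • (x - e x)) ≤ ρ (e x + r • (x - e x)) := by
  classical
  obtain ⟨f, hf, hfB, φ, hφ, hφI, hφf, hφZ⟩ := hZ.exists_push hτ hB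
  obtain ⟨D, hDc, hD⟩ := hφ.exists_countable_dependsOn
  obtain ⟨w, hw⟩ : ∃ w, w ∉ B ∪ D := by
    by_contra! h
    have h1 : Cardinal.mk (B ∪ D : Set A) = τ := by
      rw [eq_univ_of_forall h, Cardinal.mk_univ, hA]
    have h2 : Cardinal.mk (B ∪ D : Set A) < τ :=
      (Cardinal.mk_union_le B D).trans_lt
        (Cardinal.add_lt_of_lt hτ.le hB (hDc.le_aleph0.trans_lt hτ))
    exact h2.ne h1
  let e : (A → ℝ) → A → ℝ := fun x => f fun a => if a ∈ B then x a else 0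
  have he : Continuous e := by
    refine hf.comp (continuous_pi fun a => ?_)
    by_cases h : a ∈ B
    · simpa [h] using continuous_apply a
    · simpa [h] using continuous_const
  have heB : DependsOn e B := by
    intro x y hxy
    refine congrArg f (funext fun a => ?_)
    by_cases h : a ∈ B
    · simp [h, hxy a h]
    · simp [h]
  have heq : ∀ x, ∀ b ∈ B, e x b = x b := by
    intro x b hb
    simp only [e, hfB _ b hb, if_pos hb]
  have hray : ∀ x (r : ℝ), e (e x + r • (x - e x)) = e x := by
    intro x r
    refine heB fun b hb => ?_
    simp [heq x b hb]
  let ray : (A → ℝ) → ℝ → ℝ := fun x r => φ (e x + r • (x - e x))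
  have hrayc : Continuous ↿ray := by
    refine hφ.comp ?_
    have : Continuous fun p : (A → ℝ) × ℝ => e p.1 := he.comp continuous_fst
    fun_prop
  have hbdd : ∀ x, BddAbove (ray x '' Icc 0 1) := fun x =>
    ⟨1, by rintro _ ⟨r, -, rfl⟩; exact (hφI _).2⟩
  have hne : ∀ x, (ray x '' Icc 0 1).Nonempty := fun x => ⟨_, 0, by simp, rfl⟩
  refine ⟨e, fun x => 1 - sSup (ray x '' Icc 0 1), D, w, ⟨hDc, fun h => hw (Or.inl h),
    fun h => hw (Or.inr h)⟩, he, continuous_const.sub (isCompact_Icc.continuous_sSup hrayc), heB,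
    heq, ?_, ?_, ?_, ?_, ?_, ?_⟩
  · intro x y hxy
    have hxy' : ray x = ray y := by
      funext r
      have h1 : e x = e y := heB fun b hb => hxy b (Or.inl hb)
      refine hD fun a ha => ?_
      simp [h1, hxy a (Or.inr ha)]
    simp only [hxy']
  · intro x
    rw [sub_nonneg]
    refine csSup_le (hne x) ?_
    rintro _ ⟨r, -, rfl⟩
    exact (hφI _).2
  · intro x
    have : ray x 0 ≤ sSup (ray x '' Icc 0 1) := le_csSup (hbdd x) ⟨0, by simp, rfl⟩
    have h0 : 0 ≤ ray x 0 := (hφI _).1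
    linarith
  · intro z hz
    have h1 : ray z 1 = 1 := by simp [ray, hφZ z hz]
    have h2 : ray z 1 ≤ sSup (ray z '' Icc 0 1) := le_csSup (hbdd z) ⟨1, by simp, rfl⟩
    have h3 : sSup (ray z '' Icc 0 1) ≤ 1 := by
      refine csSup_le (hne z) ?_
      rintro _ ⟨r, -, rfl⟩
      exact (hφI _).2
    simp only
    linarith
  · intro x
    have h1 : e (e x) = e x := heB fun b hb => heq x b hb
    have h2 : ray (e x) '' Icc 0 1 = {0} := by
      have h3 : ∀ r, ray (e x) r = 0 := fun r => by
        simp only [ray, h1, sub_self, smul_zero, add_zero]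
        exact hφf _ ⟨_, rfl⟩
      rw [funext h3, Nonempty.image_const ⟨0, by simp⟩]
    simp [h2]
  · intro x r s hr hrs
    have hre : ∀ s t : ℝ, ray (e x + s • (x - e x)) t = ray x (t * s) := by
      intro s t
      simp only [ray, hray, add_sub_cancel_left, smul_smul]
    refine sub_le_sub_left (csSup_le (hne _) ?_) 1
    rintro _ ⟨t, ht, rfl⟩
    refine le_csSup (hbdd _) ?_
    rcases eq_or_lt_of_le (hr.trans hrs) with h0 | h0
    · have : r = 0 := le_antisymm (h0 ▸ hrs) hr
      exact ⟨t, ht, by rw [hre, hre, this, ← h0]⟩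
    · refine ⟨t * r / s, ⟨by have := ht.1; positivity, ?_⟩, ?_⟩
      · rw [div_le_one h0]
        nlinarith [ht.1, ht.2]
      · rw [hre, hre, div_mul_cancel₀ _ h0.ne.symm]

/-- Zeros depending on a parameter are continuous when the function is strictly increasing in the
unknown and continuous in the parameter. -/
theorem continuous_of_strictMono_zero {Y : Type*} [TopologicalSpace Y] {Φ : Y → ℝ → ℝ}
    (hΦ : ∀ r, Continuous fun y => Φ y r) (hmono : ∀ y, StrictMono (Φ y)) {g : Y → ℝ}
    (hg : ∀ y, Φ y (g y) = 0) : Continuous g := by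
  refine continuous_iff_continuousAt.2 fun y₀ => tendsto_order.2 ⟨fun a ha => ?_, fun a ha => ?_⟩
  · have h : Φ y₀ a < 0 := by rw [← hg y₀]; exact hmono y₀ ha
    filter_upwards [(hΦ a).continuousAt.eventually_lt continuousAt_const h] with y hy
    rw [← hg y] at hy
    exact (hmono y).lt_iff_lt.1 hy
  · have h : 0 < Φ y₀ a := by rw [← hg y₀]; exact hmono y₀ ha
    filter_upwards [continuousAt_const.eventually_lt (hΦ a).continuousAt h] with y hy
    rw [← hg y] at hy
    exact (hmono y).lt_iff_lt.1 hy

theorem abs_arctan_lt (x : ℝ) : |Real.arctan x| < Real.pi / 2 :=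
  abs_lt.2 (Real.arctan_mem_Ioo x)

/-- A bounded solution of the recurrence `2 * s n = s (n + 1) + u n` is a geometric series. -/
theorem eq_tsum_of_two_mul_eq_add {s u : ℕ → ℝ} {C : ℝ} (hs : ∀ n, |s n| ≤ C)
    (hu : ∀ n, |u n| ≤ C) (h : ∀ n, 2 * s n = s (n + 1) + u n) :
    s 0 = ∑' k, (1 / 2 : ℝ) ^ (k + 1) * u k := by
  have hpart : ∀ n, ∑ k ∈ Finset.range n, (1 / 2 : ℝ) ^ (k + 1) * u k
      = s 0 - (1 / 2) ^ n * s n := by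
    intro n
    induction n with
    | zero => simp
    | succ n ih =>
      rw [Finset.sum_range_succ, ih, show u n = 2 * s n - s (n + 1) by linarith [h n]]
      ring
  have hsum : Summable fun k => (1 / 2 : ℝ) ^ (k + 1) * u k := by
    refine Summable.of_norm_bounded (g := fun k => (1 / 2 : ℝ) ^ k * C)
      (summable_geometric_two.mul_right C) fun k => ?_
    rw [norm_mul, Real.norm_eq_abs, Real.norm_eq_abs, abs_of_pos (by positivity)]
    refine mul_le_mul ?_ (hu k) (abs_nonneg _) (by positivity)
    exact pow_le_pow_of_le_one (by norm_num) (by norm_num) (Nat.le_succ k)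
  refine tendsto_nhds_unique ?_ hsum.hasSum.tendsto_sum_nat
  simp only [hpart]
  have h0 : Filter.Tendsto (fun n => (1 / 2 : ℝ) ^ n * s n) Filter.atTop (𝓝 0) := by
    refine squeeze_zero_norm (a := fun n => (1 / 2 : ℝ) ^ n * C) (fun n => ?_) ?_
    · rw [norm_mul, Real.norm_eq_abs, Real.norm_eq_abs, abs_of_pos (by positivity)]
      exact mul_le_mul_of_nonneg_left (hs n) (by positivity)
    · simpa using (tendsto_pow_atTop_nhds_zero_of_lt_one (r := (1 / 2 : ℝ)) (by norm_num)
        (by norm_num)).mul_const C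
  simpa using h0.const_sub (s 0)

/-- Pairwise disjoint blocks of coordinates, well-ordered in sequences, each equipped with an apex
coordinate, a section over the preceding coordinates, and a height function which equals `1` on the
section and decreases along rays issuing from it. -/
structure FlatteningSystem (A J : Type*) where
  rel : J × ℕ → J × ℕ → Prop
  wf : WellFounded rel
  rel_succ : ∀ α n, rel (α, n) (α, n + 1)
  block : A → Option (J × ℕ)
  apex : J × ℕ → A
  block_apex : ∀ i, block (apex i) = some i
  sec : J × ℕ → (A → ℝ) → A → ℝ
  continuous_sec : ∀ i, Continuous (sec i)
  sec_congr : ∀ i x y, (∀ a j, block a = some j → rel j i → x a = y a) → sec i x = sec i y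
  sec_apply : ∀ i x a j, block a = some j → rel j i → sec i x a = x a
  height : J × ℕ → (A → ℝ) → ℝ
  continuous_height : ∀ i, Continuous (height i)
  height_congr : ∀ i x y, (∀ a j, block a = some j → rel j i → x a = y a) →
    (∀ a, block a = some i → a ≠ apex i → x a = y a) → height i x = height i y
  height_nonneg : ∀ i x, 0 ≤ height i x
  height_le_one : ∀ i x, height i x ≤ 1
  height_sec : ∀ i x, height i (sec i x) = 1
  height_ray : ∀ i x (r s : ℝ), 0 ≤ r → r ≤ s →
    height i (sec i x + s • (x - sec i x)) ≤ height i (sec i x + r • (x - sec i x))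

namespace FlatteningSystem

open Real

variable {A J : Type*} (S : FlatteningSystem A J)

/-- The coordinates preceding the block `i`. -/
def below (i : J × ℕ) : Set A := {a | ∃ j, S.block a = some j ∧ S.rel j i}

open Classical in
/-- The vector `t` with the coordinates preceding the block `i` erased. -/
noncomputable def direction (i : J × ℕ) (t : A → ℝ) : A → ℝ :=
  fun a => if a ∈ S.below i then 0 else t a

theorem continuous_direction (i : J × ℕ) : Continuous (S.direction i) := by
  refine continuous_pi fun a => ?_
  by_cases h : a ∈ S.below i
  · simpa [direction, h] using continuous_const
  · simpa [direction, h] using continuous_apply a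

theorem height_ray_direction (i : J × ℕ) (x t : A → ℝ) {r s : ℝ} (hr : 0 ≤ r) (hrs : r ≤ s) :
    S.height i (S.sec i x + s • S.direction i t)
      ≤ S.height i (S.sec i x + r • S.direction i t) := by
  have h : S.sec i (S.sec i x + S.direction i t) = S.sec i x := by
    refine S.sec_congr i _ _ fun a j hj hji => ?_
    have : a ∈ S.below i := ⟨j, hj, hji⟩
    simp [direction, this, S.sec_apply i x a j hj hji]
  have := S.height_ray i (S.sec i x + S.direction i t) r s hr hrs
  rwa [h, add_sub_cancel_left] at this

/-- The function whose zero is the scaling factor along the ray in direction `t`. -/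
noncomputable def scaleEqn (i : J × ℕ) (x t : A → ℝ) (q r : ℝ) : ℝ :=
  r - π / 2 * (1 + S.height i (S.sec i x + max r 0 • S.direction i t)) + 2 * |arctan q|

theorem strictMono_scaleEqn (i : J × ℕ) (x t : A → ℝ) (q : ℝ) :
    StrictMono (S.scaleEqn i x t q) := by
  intro r s hrs
  have := mul_le_mul_of_nonneg_left (S.height_ray_direction i x t (le_max_right r 0)
    (max_le_max_right 0 hrs.le)) (by positivity : (0 : ℝ) ≤ π / 2)
  simp only [scaleEqn]
  linarith

theorem continuous_scaleEqn (i : J × ℕ) :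
    Continuous fun p : ((A → ℝ) × (A → ℝ) × ℝ) × ℝ =>
      S.scaleEqn i p.1.1 p.1.2.1 p.1.2.2 p.2 := by
  have h1 : Continuous fun p : ((A → ℝ) × (A → ℝ) × ℝ) × ℝ => S.sec i p.1.1 :=
    (S.continuous_sec i).comp (by fun_prop)
  have h2 : Continuous fun p : ((A → ℝ) × (A → ℝ) × ℝ) × ℝ => S.direction i p.1.2.1 :=
    (S.continuous_direction i).comp (by fun_prop)
  have h3 : Continuous fun p : ((A → ℝ) × (A → ℝ) × ℝ) × ℝ =>
      S.height i (S.sec i p.1.1 + max p.2 0 • S.direction i p.1.2.1) :=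
    (S.continuous_height i).comp (by fun_prop)
  have h4 : Continuous fun p : ((A → ℝ) × (A → ℝ) × ℝ) × ℝ => arctan p.1.2.2 :=
    continuous_arctan.comp (by fun_prop)
  unfold scaleEqn
  fun_prop

theorem exists_scaleEqn_eq_zero (i : J × ℕ) (x t : A → ℝ) (q : ℝ) :
    ∃ r, S.scaleEqn i x t q r = 0 := by
  have hc : Continuous (S.scaleEqn i x t q) :=
    (S.continuous_scaleEqn i).comp (f := fun r => ((x, t, q), r)) (by fun_prop)
  have hq := abs_arctan_lt q
  have h0 : S.scaleEqn i x t q 0 ≤ 0 := by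
    simp only [scaleEqn, max_self, zero_smul, add_zero, S.height_sec]
    linarith
  have h1 : 0 ≤ S.scaleEqn i x t q π := by
    have h2 := S.height_le_one i (S.sec i x + max π 0 • S.direction i t)
    have h3 := mul_le_mul_of_nonneg_left h2 (by positivity : (0 : ℝ) ≤ π / 2)
    have h4 := abs_nonneg (arctan q)
    simp only [scaleEqn]
    linarith
  obtain ⟨r, -, hr⟩ := intermediate_value_Icc pi_pos.le hc.continuousOn ⟨h0, h1⟩
  exact ⟨r, hr⟩

/-- The scaling factor along the ray in direction `t`. -/
noncomputable def scale (i : J × ℕ) (x t : A → ℝ) (q : ℝ) : ℝ :=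
  (S.exists_scaleEqn_eq_zero i x t q).choose

theorem scaleEqn_scale (i : J × ℕ) (x t : A → ℝ) (q : ℝ) :
    S.scaleEqn i x t q (S.scale i x t q) = 0 :=
  (S.exists_scaleEqn_eq_zero i x t q).choose_spec

theorem scale_pos (i : J × ℕ) (x t : A → ℝ) (q : ℝ) : 0 < S.scale i x t q := by
  rw [← (S.strictMono_scaleEqn i x t q).lt_iff_lt, scaleEqn_scale]
  have hq := abs_arctan_lt q
  simp only [scaleEqn, max_self, zero_smul, add_zero, S.height_sec]
  linarith

theorem scale_eq (i : J × ℕ) (x t : A → ℝ) (q : ℝ) :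
    S.scale i x t q = π / 2 *
      (1 + S.height i (S.sec i x + S.scale i x t q • S.direction i t)) - 2 * |arctan q| := by
  have h := S.scaleEqn_scale i x t q
  rw [scaleEqn, max_eq_left (S.scale_pos i x t q).le] at h
  linarith

theorem continuous_scale (i : J × ℕ) :
    Continuous fun p : (A → ℝ) × (A → ℝ) × ℝ => S.scale i p.1 p.2.1 p.2.2 :=
  continuous_of_strictMono_zero (Φ := fun p r => S.scaleEqn i p.1 p.2.1 p.2.2 r)
    (fun r => (S.continuous_scaleEqn i).comp (f := fun p => (p, r)) (by fun_prop))
    (fun p => S.strictMono_scaleEqn i p.1 p.2.1 p.2.2) fun p => S.scaleEqn_scale i p.1 p.2.1 p.2.2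

/-- The height of the point of the ray in direction `t` selected by the scaling factor. -/
noncomputable def scaledHeight (i : J × ℕ) (x t : A → ℝ) (q : ℝ) : ℝ :=
  S.height i (S.sec i x + S.scale i x t q • S.direction i t)

theorem continuous_scaledHeight (i : J × ℕ) :
    Continuous fun p : (A → ℝ) × (A → ℝ) × ℝ => S.scaledHeight i p.1 p.2.1 p.2.2 := by
  have h1 : Continuous fun p : (A → ℝ) × (A → ℝ) × ℝ => S.sec i p.1 :=
    (S.continuous_sec i).comp continuous_fst
  have h2 : Continuous fun p : (A → ℝ) × (A → ℝ) × ℝ => S.direction i p.2.1 :=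
    (S.continuous_direction i).comp (by fun_prop)
  exact (S.continuous_height i).comp (h1.add ((S.continuous_scale i).smul h2))

end FlatteningSystem

open Real in
theorem strictMono_arctan_add_mul_arctan {h : ℝ} (hh : 0 ≤ h) (u c : ℝ) :
    StrictMono fun s => arctan s + h * arctan (u + s) - c := by
  intro r s hrs
  have h1 := arctan_strictMono hrs
  have h2 := mul_le_mul_of_nonneg_left
    (arctan_strictMono.monotone (add_le_add_right hrs.le u)) hh
  simp only
  linarith

open Real Filter in
theorem exists_arctan_add_mul_arctan_eq_zero {h : ℝ} (u : ℝ) {c : ℝ}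
    (hc : |c| < π / 2 * (1 + h)) : ∃ s, arctan s + h * arctan (u + s) - c = 0 := by
  have hcont : Continuous fun s => arctan s + h * arctan (u + s) - c := by fun_prop
  rw [abs_lt] at hc
  have htop : Tendsto (fun s => arctan s + h * arctan (u + s) - c) atTop
      (𝓝 (π / 2 + h * (π / 2) - c)) := by
    have h1 : Tendsto arctan atTop (𝓝 (π / 2)) := tendsto_arctan_atTop.mono_right nhdsWithin_le_nhds
    exact (h1.add ((h1.comp (tendsto_atTop_add_const_left _ u tendsto_id)).const_mul h)).sub_const c
  have hbot : Tendsto (fun s => arctan s + h * arctan (u + s) - c) atBot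
      (𝓝 (-(π / 2) + h * -(π / 2) - c)) := by
    have h1 : Tendsto arctan atBot (𝓝 (-(π / 2))) :=
      tendsto_arctan_atBot.mono_right nhdsWithin_le_nhds
    exact (h1.add ((h1.comp (tendsto_atBot_add_const_left _ u tendsto_id)).const_mul h)).sub_const c
  have ht := htop.eventually (eventually_gt_nhds (show 0 < π / 2 + h * (π / 2) - c by linarith))
  have hb := hbot.eventually (eventually_lt_nhds (show -(π / 2) + h * -(π / 2) - c < 0 by linarith))
  exact mem_range_of_exists_le_of_exists_ge hcont (hb.exists.imp fun _ => le_of_lt)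
    (ht.exists.imp fun _ => le_of_lt)

namespace FlatteningSystem

open Real

variable {A J : Type*} (S : FlatteningSystem A J)

theorem abs_two_mul_arctan_lt (i : J × ℕ) (x t : A → ℝ) (q : ℝ) :
    |2 * arctan q| < π / 2 * (1 + S.scaledHeight i x t q) := by
  have h1 := S.scale_eq i x t q
  have h2 := S.scale_pos i x t q
  rw [abs_mul, abs_two, scaledHeight]
  linarith

/-- The state passed on by the block `i`. -/
noncomputable def next (i : J × ℕ) (x t : A → ℝ) (q : ℝ) : ℝ :=
  (exists_arctan_add_mul_arctan_eq_zero (t (S.apex i)) (S.abs_two_mul_arctan_lt i x t q)).choose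

theorem next_spec (i : J × ℕ) (x t : A → ℝ) (q : ℝ) :
    arctan (S.next i x t q) + S.scaledHeight i x t q * arctan (t (S.apex i) + S.next i x t q)
      - 2 * arctan q = 0 :=
  (exists_arctan_add_mul_arctan_eq_zero (t (S.apex i))
    (S.abs_two_mul_arctan_lt i x t q)).choose_spec

theorem continuous_next (i : J × ℕ) :
    Continuous fun p : (A → ℝ) × (A → ℝ) × ℝ => S.next i p.1 p.2.1 p.2.2 := by
  refine continuous_of_strictMono_zero
    (Φ := fun p s => arctan s + S.scaledHeight i p.1 p.2.1 p.2.2 *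
      arctan (p.2.1 (S.apex i) + s) - 2 * arctan p.2.2) (fun s => ?_)
    (fun p => strictMono_arctan_add_mul_arctan (S.height_nonneg i _) _ _)
    fun p => S.next_spec i p.1 p.2.1 p.2.2
  have := S.continuous_scaledHeight i
  fun_prop

open Classical in
/-- The values in the block `i`, and the state passed on. -/
noncomputable def solve (i : J × ℕ) (x t : A → ℝ) (q : ℝ) : (A → ℝ) × ℝ :=
  (fun a => if a = S.apex i then t a + S.next i x t q
    else S.sec i x a + S.scale i x t q * t a, S.next i x t q)

theorem continuous_solve (i : J × ℕ) :
    Continuous fun p : (A → ℝ) × (A → ℝ) × ℝ => S.solve i p.1 p.2.1 p.2.2 := by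
  have h1 := S.continuous_next i
  have h2 := S.continuous_scale i
  refine Continuous.prodMk (continuous_pi fun a => ?_) h1
  by_cases h : a = S.apex i
  · simp only [h, if_true]
    fun_prop
  · simp only [h, if_false]
    have h3 : Continuous fun p : (A → ℝ) × (A → ℝ) × ℝ => S.sec i p.1 a :=
      (continuous_apply a).comp ((S.continuous_sec i).comp continuous_fst)
    fun_prop

open Classical in
/-- The vector assembled from the blocks preceding `i`. -/
noncomputable def assemble (i : J × ℕ) (v : ∀ j, S.rel j i → (A → ℝ) × ℝ) : A → ℝ := fun a =>
  match S.block a with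
  | none => 0
  | some j => if h : S.rel j i then (v j h).1 a else 0

/-- The state entering the block `i`. -/
def incoming (q : J → ℝ) : (i : J × ℕ) → (∀ j, S.rel j i → (A → ℝ) × ℝ) → ℝ
  | (α, 0), _ => q α
  | (α, n + 1), v => (v (α, n) (S.rel_succ α n)).2

/-- The recursively computed block values and states of the inverse. -/
noncomputable def value (d : (A → ℝ) × (J → ℝ)) : J × ℕ → (A → ℝ) × ℝ :=
  S.wf.fix fun i v => S.solve i (S.assemble i v) d.1 (S.incoming d.2 i v)

theorem value_eq (d : (A → ℝ) × (J → ℝ)) (i : J × ℕ) :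
    S.value d i = S.solve i (S.assemble i fun j _ => S.value d j) d.1
      (S.incoming d.2 i fun j _ => S.value d j) :=
  S.wf.fix_eq _ i

theorem continuous_value (i : J × ℕ) : Continuous fun d => S.value d i := by
  induction i using S.wf.induction with
  | _ i ih =>
    have h1 : Continuous fun d => S.assemble i fun j _ => S.value d j := by
      refine continuous_pi fun a => ?_
      unfold assemble
      split
      · exact continuous_const
      · next j _ =>
        by_cases h : S.rel j i
        · simp only [h, dif_pos]
          have := ih j h
          fun_prop
        · simp only [h, dif_neg, not_false_eq_true]
          exact continuous_const
    have h2 : Continuous fun d : (A → ℝ) × (J → ℝ) =>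
        S.incoming d.2 i fun j _ => S.value d j := by
      rcases i with ⟨α, _ | n⟩
      · simp only [incoming]
        fun_prop
      · simp only [incoming]
        exact (ih _ (S.rel_succ α n)).snd
    simp only [S.value_eq _ i]
    exact (S.continuous_solve i).comp (h1.prodMk (continuous_fst.prodMk h2))

/-- The inverse of the flattening. -/
noncomputable def unflatten (d : (A → ℝ) × (J → ℝ)) : A → ℝ := fun a =>
  match S.block a with
  | none => d.1 a
  | some j => (S.value d j).1 a

theorem continuous_unflatten : Continuous S.unflatten := by
  refine continuous_pi fun a => ?_
  unfold unflatten
  split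
  · fun_prop
  · next j _ =>
    have := S.continuous_value j
    fun_prop

/-- The state of the inverse at the block `i`. -/
noncomputable def state (d : (A → ℝ) × (J → ℝ)) : J × ℕ → ℝ
  | (α, 0) => d.2 α
  | (α, n + 1) => (S.value d (α, n)).2

theorem value_eq_solve (d : (A → ℝ) × (J → ℝ)) (i : J × ℕ) :
    ∃ x, S.sec i x = S.sec i (S.unflatten d) ∧ S.value d i = S.solve i x d.1 (S.state d i) := by
  refine ⟨S.assemble i fun j _ => S.value d j, S.sec_congr i _ _ fun a j hj hji => ?_, ?_⟩
  · simp [assemble, unflatten, hj, hji]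
  · rw [S.value_eq]
    rcases i with ⟨α, _ | n⟩ <;> rfl

theorem height_eq_of_forall_eq {i : J × ℕ} {y t : A → ℝ} {r : ℝ}
    (h : ∀ a, S.block a = some i → a ≠ S.apex i → y a = S.sec i y a + r * t a) :
    S.height i (S.sec i y + r • S.direction i t) = S.height i y := by
  refine S.height_congr _ _ _ (fun a j hj hji => ?_) fun a ha hne => ?_
  · have h1 : a ∈ S.below i := ⟨j, hj, hji⟩
    simp [direction, h1, S.sec_apply _ _ a j hj hji]
  · rw [h a ha hne]
    have h1 : a ∉ S.below i := by
      rintro ⟨j, hj, hji⟩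
      rw [ha] at hj
      cases hj
      exact S.wf.irrefl.irrefl _ hji
    simp [direction, h1]

theorem unflatten_spec (d : (A → ℝ) × (J → ℝ)) (α : J) (n : ℕ) :
    0 < π / 2 * (1 + S.height (α, n) (S.unflatten d)) - 2 * |arctan (S.state d (α, n))| ∧
    (∀ a, S.block a = some (α, n) → a ≠ S.apex (α, n) →
      S.unflatten d a = S.sec (α, n) (S.unflatten d) a +
        (π / 2 * (1 + S.height (α, n) (S.unflatten d)) - 2 * |arctan (S.state d (α, n))|) * d.1 a) ∧
    S.unflatten d (S.apex (α, n)) = d.1 (S.apex (α, n)) + S.state d (α, n + 1) ∧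
    2 * arctan (S.state d (α, n)) = arctan (S.state d (α, n + 1)) +
      S.height (α, n) (S.unflatten d) * arctan (S.unflatten d (S.apex (α, n))) := by
  obtain ⟨x, hx, hv⟩ := S.value_eq_solve d (α, n)
  have happ : ∀ a, S.block a = some (α, n) → S.unflatten d a = (S.value d (α, n)).1 a := by
    intro a ha
    simp [unflatten, ha]
  have hother : ∀ a, S.block a = some (α, n) → a ≠ S.apex (α, n) → S.unflatten d a =
      S.sec (α, n) (S.unflatten d) a + S.scale (α, n) x d.1 (S.state d (α, n)) * d.1 a := by
    intro a ha hne
    rw [happ a ha, hv, ← hx]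
    simp [solve, hne]
  have hheight : S.scaledHeight (α, n) x d.1 (S.state d (α, n))
      = S.height (α, n) (S.unflatten d) := by
    rw [scaledHeight, hx]
    exact S.height_eq_of_forall_eq hother
  have hscale := S.scale_eq (α, n) x d.1 (S.state d (α, n))
  rw [← scaledHeight, hheight] at hscale
  have hapex : S.unflatten d (S.apex (α, n)) = d.1 (S.apex (α, n)) + S.state d (α, n + 1) := by
    rw [happ _ (S.block_apex _), state, hv]
    simp [solve]
  refine ⟨hscale ▸ S.scale_pos _ _ _ _, hscale ▸ hother, hapex, ?_⟩
  have h := S.next_spec (α, n) x d.1 (S.state d (α, n))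
  rw [hapex, ← hheight, state, hv]
  simp only [solve]
  linarith

end FlatteningSystem

namespace FlatteningSystem

open Real

variable {A J : Type*} (S : FlatteningSystem A J)

/-- The contribution of the block `i` to the potentials. -/
noncomputable def term (x : A → ℝ) (i : J × ℕ) : ℝ := S.height i x * arctan (x (S.apex i))

theorem abs_term_le (x : A → ℝ) (i : J × ℕ) : |S.term x i| ≤ π / 2 * S.height i x := by
  rw [term, abs_mul, abs_of_nonneg (S.height_nonneg i x), mul_comm]
  exact mul_le_mul_of_nonneg_right (abs_arctan_lt _).le (S.height_nonneg i x)

theorem abs_term_lt (x : A → ℝ) (i : J × ℕ) : |S.term x i| < π / 2 := by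
  rw [term, abs_mul, abs_of_nonneg (S.height_nonneg i x)]
  exact (mul_le_of_le_one_left (abs_nonneg _) (S.height_le_one i x)).trans_lt (abs_arctan_lt _)

theorem continuous_term (i : J × ℕ) : Continuous fun x => S.term x i := by
  have := S.continuous_height i
  unfold term
  fun_prop

/-- The potential of the block `i`: a weighted sum of the contributions of the blocks following
it in its sequence. -/
noncomputable def pot (x : A → ℝ) (i : J × ℕ) : ℝ :=
  ∑' k : ℕ, (1 / 2 : ℝ) ^ (k + 1) * S.term x (i.1, i.2 + k)

theorem norm_pot_summand_le (x : A → ℝ) (i : J × ℕ) (k : ℕ) :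
    ‖(1 / 2 : ℝ) ^ (k + 1) * S.term x (i.1, i.2 + k)‖ ≤ (1 / 2 : ℝ) ^ k * (π / 4) := by
  rw [norm_mul, norm_eq_abs, norm_eq_abs, abs_of_pos (by positivity), pow_succ]
  have := mul_le_mul_of_nonneg_left (S.abs_term_lt x (i.1, i.2 + k)).le
    (by positivity : (0 : ℝ) ≤ (1 / 2) ^ k * (1 / 2))
  linarith

theorem summable_bound : Summable fun k : ℕ => (1 / 2 : ℝ) ^ k * (π / 4) :=
  summable_geometric_two.mul_right _

theorem summable_pot (x : A → ℝ) (i : J × ℕ) :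
    Summable fun k : ℕ => (1 / 2 : ℝ) ^ (k + 1) * S.term x (i.1, i.2 + k) :=
  Summable.of_norm_bounded summable_bound (S.norm_pot_summand_le x i)

theorem continuous_pot (i : J × ℕ) : Continuous fun x => S.pot x i :=
  continuous_tsum (fun k => (S.continuous_term (i.1, i.2 + k)).const_mul _) summable_bound
    fun k x => S.norm_pot_summand_le x i k

theorem abs_pot_le (x : A → ℝ) (i : J × ℕ) : |S.pot x i| ≤ π / 2 := by
  have h := tsum_of_norm_bounded (summable_bound.hasSum) (S.norm_pot_summand_le x i)
  rw [tsum_mul_right, tsum_geometric_two, norm_eq_abs] at h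
  rw [pot]
  linarith

theorem two_mul_pot (x : A → ℝ) (i : J × ℕ) :
    2 * S.pot x i = S.pot x (i.1, i.2 + 1) + S.term x i := by
  rw [pot, (S.summable_pot x i).tsum_eq_zero_add, pot, mul_add, ← tsum_mul_left, add_comm]
  congr 1
  · refine tsum_congr fun k => ?_
    rw [show i.2 + (k + 1) = i.2 + 1 + k by ring]
    ring
  · simp

theorem abs_pot_lt (x : A → ℝ) (i : J × ℕ) : |S.pot x i| < π / 2 := by
  have h1 := abs_add_le (S.pot x (i.1, i.2 + 1)) (S.term x i)
  have h2 := S.abs_pot_le x (i.1, i.2 + 1)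
  have h3 := S.abs_term_lt x i
  rw [← two_mul_pot, abs_mul, abs_two] at h1
  linarith

theorem arctan_tan_pot (x : A → ℝ) (i : J × ℕ) : arctan (tan (S.pot x i)) = S.pot x i :=
  arctan_tan (abs_lt.1 (S.abs_pot_lt x i)).1 (abs_lt.1 (S.abs_pot_lt x i)).2

theorem continuous_tan_pot (i : J × ℕ) : Continuous fun x => tan (S.pot x i) :=
  continuousOn_tan_Ioo.comp_continuous (S.continuous_pot i) fun x => abs_lt.1 (S.abs_pot_lt x i)

/-- The scaling factor of the block `i` read off from a vector. -/
noncomputable def factor (x : A → ℝ) (i : J × ℕ) : ℝ :=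
  π / 2 * (1 + S.height i x) - 2 * |S.pot x i|

theorem factor_pos (x : A → ℝ) (i : J × ℕ) : 0 < S.factor x i := by
  have h1 := abs_add_le (S.pot x (i.1, i.2 + 1)) (S.term x i)
  have h2 := S.abs_pot_lt x (i.1, i.2 + 1)
  have h3 := S.abs_term_le x i
  rw [← two_mul_pot, abs_mul, abs_two] at h1
  rw [factor]
  linarith

theorem continuous_factor (i : J × ℕ) : Continuous fun x => S.factor x i := by
  have h1 := S.continuous_height i
  have h2 := S.continuous_pot i
  unfold factor
  fun_prop

open Classical in
/-- The flattening: it replaces the vector in each block by its rescaled difference to the section,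
and records the potentials of the sequences. -/
noncomputable def flatten (x : A → ℝ) : (A → ℝ) × (J → ℝ) :=
  (fun a => match S.block a with
    | none => x a
    | some i => if a = S.apex i then x a - tan (S.pot x (i.1, i.2 + 1))
      else (x a - S.sec i x a) / S.factor x i,
   fun α => tan (S.pot x (α, 0)))

theorem continuous_flatten : Continuous S.flatten := by
  refine Continuous.prodMk (continuous_pi fun a => ?_)
    (continuous_pi fun α => S.continuous_tan_pot _)
  cases S.block a with
  | none => exact continuous_apply a
  | some i =>
    by_cases h : a = S.apex i
    · simp only [h, if_true]
      exact (continuous_apply _).sub (S.continuous_tan_pot _)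
    · simp only [h, if_false]
      exact ((continuous_apply a).sub ((continuous_apply a).comp (S.continuous_sec i))).div
        (S.continuous_factor i) fun x => (S.factor_pos x i).ne'

theorem flatten_unflatten (d : (A → ℝ) × (J → ℝ)) : S.flatten (S.unflatten d) = d := by
  have hpot : ∀ i, S.pot (S.unflatten d) i = arctan (S.state d i) := by
    intro i
    refine (eq_tsum_of_two_mul_eq_add (s := fun k => arctan (S.state d (i.1, i.2 + k)))
      (C := π / 2) (fun k => (abs_arctan_lt _).le) (fun k => (S.abs_term_lt _ _).le)
      fun k => ?_).symm
    exact (S.unflatten_spec d i.1 (i.2 + k)).2.2.2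
  refine Prod.ext (funext fun a => ?_) (funext fun α => ?_)
  · rcases hb : S.block a with _ | ⟨α, n⟩
    · simp [flatten, unflatten, hb]
    · obtain ⟨hpos, hother, hapex, -⟩ := S.unflatten_spec d α n
      by_cases h : a = S.apex (α, n)
      · simp only [flatten, hb, if_pos h, hpot, tan_arctan]
        rw [h, hapex, add_sub_cancel_right]
      · simp only [flatten, hb, if_neg h, factor, hpot]
        rw [hother a hb h, add_sub_cancel_left, mul_div_cancel_left₀ _ hpos.ne']
  · simp [flatten, hpot, state]

theorem unflatten_flatten (x : A → ℝ) : S.unflatten (S.flatten x) = x := by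
  set d := S.flatten x with hd
  set y := S.unflatten d with hy
  have key : ∀ i : J × ℕ, (∀ a, S.block a = some i → y a = x a) ∧
      S.state d (i.1, i.2 + 1) = tan (S.pot x (i.1, i.2 + 1)) := by
    intro i
    induction i using S.wf.induction with
    | _ i ih =>
      rcases i with ⟨α, n⟩
      have hsec : S.sec (α, n) y = S.sec (α, n) x :=
        S.sec_congr _ _ _ fun a j hj hji => (ih j hji).1 a hj
      have hq : arctan (S.state d (α, n)) = S.pot x (α, n) := by
        rw [← S.arctan_tan_pot]
        congr 1
        cases n with
        | zero => rfl
        | succ n => exact (ih _ (S.rel_succ α n)).2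
      obtain ⟨hpos, hother, hapex, hrec⟩ := S.unflatten_spec d α n
      rw [hq] at hpos hother hrec
      have hx : ∀ a, S.block a = some (α, n) → a ≠ S.apex (α, n) →
          x a = S.sec (α, n) x a + S.factor x (α, n) * d.1 a := by
        intro a ha hne
        have := (S.factor_pos x (α, n)).ne'
        simp only [hd, flatten, ha, if_neg hne]
        field_simp
        ring
      have hxapex : x (S.apex (α, n)) = d.1 (S.apex (α, n)) + tan (S.pot x (α, n + 1)) := by
        simp [hd, flatten, S.block_apex]
      have hfac : π / 2 * (1 + S.height (α, n) y) - 2 * |S.pot x (α, n)| = S.factor x (α, n) := by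
        refine (S.strictMono_scaleEqn (α, n) x d.1 (S.state d (α, n))).injective ?_
        rw [scaleEqn, scaleEqn, max_eq_left hpos.le, max_eq_left (S.factor_pos x _).le, hq,
          S.height_eq_of_forall_eq hx, ← hsec, S.height_eq_of_forall_eq hother, factor]
        ring
      have hheight : S.height (α, n) y = S.height (α, n) x := by
        rw [factor] at hfac
        have := pi_pos
        have h1 : π * (S.height (α, n) y - S.height (α, n) x) = 0 := by linarith
        rcases mul_eq_zero.1 h1 with h2 | h2 <;> linarith
      have hnext : S.state d (α, n + 1) = tan (S.pot x (α, n + 1)) := by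
        refine (strictMono_arctan_add_mul_arctan (S.height_nonneg (α, n) x)
          (d.1 (S.apex (α, n))) (2 * S.pot x (α, n))).injective ?_
        have hterm := S.two_mul_pot x (α, n)
        rw [← hy, hheight] at hrec
        rw [term] at hterm
        rw [← hxapex, ← hapex, S.arctan_tan_pot, ← hy]
        dsimp only at hterm
        linarith
      refine ⟨fun a ha => ?_, hnext⟩
      by_cases h : a = S.apex (α, n)
      · rw [h, hxapex, ← hnext, ← hapex]
      · rw [hx a ha h, ← hsec, ← hfac]
        exact hother a ha h
  funext a
  rcases hb : S.block a with _ | i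
  · simp [hy, hd, unflatten, flatten, hb]
  · exact (key i).1 a hb

/-- The flattening as a homeomorphism. -/
noncomputable def flattenHomeomorph : (A → ℝ) ≃ₜ (A → ℝ) × (J → ℝ) where
  toFun := S.flatten
  invFun := S.unflatten
  left_inv := S.unflatten_flatten
  right_inv := S.flatten_unflatten
  continuous_toFun := S.continuous_flatten
  continuous_invFun := S.continuous_unflatten

theorem flattenHomeomorph_snd_eq_zero {z : A → ℝ} (hz : ∀ i, S.height i z = 0) :
    (S.flattenHomeomorph z).2 = 0 := by
  funext α
  change tan (S.pot z (α, 0)) = 0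
  simp [pot, term, hz]

end FlatteningSystem

theorem mk_setOf_prodLex_lt {τ : Cardinal.{u}} (hτ : Cardinal.aleph0 < τ)
    (i : τ.ord.ToType × ℕ) :
    Cardinal.mk {j : τ.ord.ToType × ℕ | Prod.Lex (· < ·) (· < ·) j i} < τ := by
  have h1 : Cardinal.mk (Iic i.1) < τ := by
    rw [← Iio_insert]
    have h : Cardinal.mk (Iio i.1) < τ := by
      simpa using Cardinal.mk_Iio_lt i.1 (by simp)
    exact (Cardinal.mk_insert_le).trans_lt (Cardinal.add_lt_of_lt hτ.le h
      (Cardinal.one_lt_aleph0.trans hτ))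
  have h2 : {j : τ.ord.ToType × ℕ | Prod.Lex (· < ·) (· < ·) j i} ⊆ Iic i.1 ×ˢ univ := by
    intro j hj
    rcases Prod.lex_def.1 hj with h | h
    · exact ⟨h.le, mem_univ _⟩
    · exact ⟨h.1.le, mem_univ _⟩
  refine (Cardinal.mk_le_mk_of_subset h2).trans_lt ?_
  rw [Cardinal.mk_congr (Equiv.Set.prod _ _), Cardinal.mk_prod, Cardinal.mk_univ, Cardinal.mk_nat]
  simpa using Cardinal.mul_lt_of_lt hτ.le h1 hτ

theorem ZTauSet.exists_flatteningSystem {A : Type u} {τ : Cardinal.{u}} (hτ : Cardinal.aleph0 < τ)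
    (hA : Cardinal.mk A = τ) {Z : Set (A → ℝ)} (hZ : ZTauSet τ Z) :
    ∃ S : FlatteningSystem A τ.ord.ToType, ∀ z ∈ Z, ∀ i, S.height i z = 0 := by
  classical
  choose e ρ D w hDw he hρ heB heq hρD hρ0 hρ1 hρZ hρe hray using
    fun (B : Set A) (hB : Cardinal.mk B < τ) => hZ.exists_section hτ hA hB
  let r : τ.ord.ToType × ℕ → τ.ord.ToType × ℕ → Prop := Prod.Lex (· < ·) (· < ·)
  have hr : WellFounded r := WellFounded.prod_lex wellFounded_lt wellFounded_lt
  let c : Set A → Set A := fun B =>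
    if hB : Cardinal.mk B < τ then insert (w B hB) (D B hB) \ B else ∅
  have hc : ∀ B, (c B).Countable := by
    intro B
    by_cases hB : Cardinal.mk B < τ
    · simp only [c, hB, dif_pos]
      exact ((hDw B hB).1.insert _).mono sdiff_subset
    · simp [c, hB]
  let C : τ.ord.ToType × ℕ → Set A := hr.fix fun i v => c (⋃ j, ⋃ h : r j i, v j h)
  let P : τ.ord.ToType × ℕ → Set A := fun i => ⋃ j, ⋃ _ : r j i, C j
  have hC : ∀ i, C i = c (P i) := fun i => hr.fix_eq _ i
  have hP : ∀ i, Cardinal.mk (P i) < τ := by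
    intro i
    refine (Cardinal.mk_biUnion_le C {j | r j i}).trans_lt ?_
    refine Cardinal.mul_lt_of_lt hτ.le (mk_setOf_prodLex_lt hτ i) ?_
    refine lt_of_le_of_lt (ciSup_le' fun j => ?_) hτ
    rw [hC]
    exact (hc _).le_aleph0
  have hC' : ∀ i, C i = insert (w (P i) (hP i)) (D (P i) (hP i)) \ P i := by
    intro i
    rw [hC]
    simp [c, hP i]
  have hlt : ∀ i j a, r j i → a ∈ C i → a ∉ C j := by
    intro i j a hji hi hj
    rw [hC'] at hi
    exact hi.2 (mem_biUnion (t := C) hji hj)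
  have htri : ∀ i j, r i j ∨ i = j ∨ r j i := fun i j =>
    trichotomous_of r i j
  have huniq : ∀ i j a, a ∈ C i → a ∈ C j → i = j := by
    intro i j a hi hj
    rcases htri i j with h | h | h
    · exact absurd hi (hlt _ _ _ h hj)
    · exact h
    · exact absurd hj (hlt _ _ _ h hi)
  let block : A → Option (τ.ord.ToType × ℕ) := fun a =>
    if h : ∃ i, a ∈ C i then some h.choose else none
  have hblock : ∀ a i, block a = some i ↔ a ∈ C i := by
    intro a i
    by_cases h : ∃ i, a ∈ C i
    · simp only [block, h, dif_pos, Option.some.injEq]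
      exact ⟨fun hi => hi ▸ h.choose_spec, fun hi => huniq _ _ a h.choose_spec hi⟩
    · simp only [block, h, dif_neg, not_false_eq_true, reduceCtorEq, false_iff]
      exact fun hi => h ⟨i, hi⟩
  have hmem : ∀ i a, a ∈ P i ↔ ∃ j, block a = some j ∧ r j i := by
    intro i a
    simp [P, hblock, and_comm]
  refine ⟨{
    rel := r
    wf := hr
    rel_succ := fun α n => Prod.Lex.right _ n.lt_succ_self
    block := block
    apex := fun i => w (P i) (hP i)
    block_apex := fun i => by
      rw [hblock, hC']
      exact ⟨mem_insert _ _, (hDw _ _).2.1⟩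
    sec := fun i => e (P i) (hP i)
    continuous_sec := fun i => he _ _
    sec_congr := fun i x y h => heB _ _ fun a ha => by
      obtain ⟨j, hj, hji⟩ := (hmem i a).1 ha
      exact h a j hj hji
    sec_apply := fun i x a j hj hji => heq _ _ _ _ ((hmem i a).2 ⟨j, hj, hji⟩)
    height := fun i => ρ (P i) (hP i)
    continuous_height := fun i => hρ _ _
    height_congr := fun i x y h h' => hρD _ _ fun a ha => by
      by_cases hPa : a ∈ P i
      · obtain ⟨j, hj, hji⟩ := (hmem i a).1 hPa
        exact h a j hj hji
      · have hDa := ha.resolve_left hPa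
        refine h' a ?_ ?_
        · rw [hblock, hC']
          exact ⟨mem_insert_of_mem _ hDa, hPa⟩
        · rintro rfl
          exact (hDw _ _).2.2 hDa
    height_nonneg := fun i => hρ0 _ _
    height_le_one := fun i => hρ1 _ _
    height_sec := fun i => hρe _ _
    height_ray := fun i => hray _ _ }, fun z hz i => hρZ _ _ z hz⟩

/-- Euclidean space of uncountable weight is homeomorphic to its square so that a given `Z_τ`-set
is carried into a factor. -/
theorem ZTauSet.exists_homeomorph_prod {A : Type u} {τ : Cardinal.{u}} (hτ : Cardinal.aleph0 < τ)
    (hA : Cardinal.mk A = τ) {Z : Set (A → ℝ)} (hZ : ZTauSet τ Z) :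
    ∃ G : (A → ℝ) ≃ₜ (A → ℝ) × (A → ℝ), ∀ z ∈ Z, (G z).2 = 0 := by
  obtain ⟨S, hS⟩ := hZ.exists_flatteningSystem hτ hA
  obtain ⟨σ⟩ := Cardinal.eq.1 (τ.mk_ord_toType.trans hA.symm)
  refine ⟨S.flattenHomeomorph.trans ((Homeomorph.refl _).prodCongr
    (Homeomorph.piCongrLeft (Y := fun _ => ℝ) σ)), fun z hz => ?_⟩
  have h := S.flattenHomeomorph_snd_eq_zero (hS z hz)
  funext a
  obtain ⟨j, rfl⟩ := σ.surjective a
  change (Homeomorph.piCongrLeft (Y := fun _ => ℝ) σ) (S.flattenHomeomorph z).2 (σ j) = 0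
  rw [Homeomorph.piCongrLeft_apply_apply, h]
  rfl

/-- Two copies of a space embedded in the two factors of a product are carried to each other by a
homeomorphism of the product. -/
theorem exists_homeomorph_prod_swap {E : Type*} [AddCommGroup E] [TopologicalSpace E]
    [IsTopologicalAddGroup E] {p q : E → E} (hp : Continuous p) (hq : Continuous q) :
    ∃ K : E × E ≃ₜ E × E, ∀ v, q (p v) = v → K (v, 0) = (p v, 0) := by
  refine ⟨⟨⟨fun x => (x.2 + p x.1, x.1 - q (x.2 + p x.1)),
    fun y => (y.2 + q y.1, y.1 - p (y.2 + q y.1)), fun x => by simp, fun y => by simp⟩,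
    by fun_prop, by fun_prop⟩, fun v hv => ?_⟩
  simp [hv]

/-- A continuous map on a `C`-embedded subset with values in a power of the line extends. -/
theorem CEmbedded.exists_extension {X B : Type*} [TopologicalSpace X] {Z : Set X}
    (hZ : CEmbedded Z) {f : Z → B → ℝ} (hf : Continuous f) :
    ∃ g : X → B → ℝ, Continuous g ∧ ∀ z : Z, g z = f z := by
  choose g hg hgf using fun b => hZ (fun z => f z b) ((continuous_apply b).comp hf)
  exact ⟨fun x b => g b x, continuous_pi hg, fun z => funext fun b => hgf b z⟩

/-- `Z_τ`-set unknotting in `ℝ^τ` for `τ > ω`. -/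
theorem Z_tau_unknotting_R_tau
    (τ : Cardinal.{u}) (hτ : Cardinal.aleph0 < τ)
    (A : Type u) (hA : Cardinal.mk A = τ)
    (Z F : Set (A → ℝ)) (hZ : ZTauSet τ Z) (hF : ZTauSet τ F)
    (hZC : CEmbedded Z) (hFC : CEmbedded F)
    (h : ↥Z ≃ₜ ↥F) :
    ∃ H : (A → ℝ) ≃ₜ (A → ℝ),
      ∀ z : Z, H (z : A → ℝ) = (h z : A → ℝ) := by
  obtain ⟨G, hG⟩ := hZ.exists_homeomorph_prod hτ hA
  obtain ⟨G', hG'⟩ := hF.exists_homeomorph_prod hτ hA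
  obtain ⟨p, hp, hpz⟩ := hZC.exists_extension (f := fun z => (G' (h z)).1) (by fun_prop)
  obtain ⟨q, hq, hqf⟩ := hFC.exists_extension (f := fun y => (G (h.symm y)).1) (by fun_prop)
  obtain ⟨K, hK⟩ := exists_homeomorph_prod_swap (p := fun v => p (G.symm (v, 0)))
    (q := fun v => q (G'.symm (v, 0))) (by fun_prop) (by fun_prop)
  refine ⟨(G.trans K).trans G'.symm, fun z => ?_⟩
  have h1 : G z = ((G z).1, 0) := Prod.ext rfl (hG z z.2)
  have h2 : G' (h z) = ((G' (h z)).1, 0) := Prod.ext rfl (hG' _ (h z).2)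
  have h3 : p (G.symm ((G z).1, 0)) = (G' (h z)).1 := by
    rw [← h1, G.symm_apply_apply, hpz]
  have h4 : q (G'.symm ((G' (h z)).1, 0)) = (G z).1 := by
    rw [← h2, G'.symm_apply_apply, hqf, h.symm_apply_apply]
  have h5 := hK (G z).1 (by simp only [h3, h4])
  simp only [h3] at h5
  simp only [Homeomorph.trans_apply]
  rw [h1, h5, ← h2, G'.symm_apply_apply]
end

section
/- Let τ > ω be a cardinal and let Z and F be closed C-embedded Z_τ-sets in ℝ^τ. Then the following conditions are equivalent: (i) Z and F are homeomorphic; (ii) ℝ^τ ∖ Z and ℝ^τ ∖ F are homeomorphic. -/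
open Set Topology

universe u

namespace RealPower

open MeasureTheory ProbabilityTheory

variable {A : Type u}

/-- Uncountable powers of `ℝ` satisfy the countable chain condition, stated for open boxes. -/
theorem countable_of_pairwiseDisjoint_boxes (𝒟 : Set (Set (A → ℝ)))
    (hbox : ∀ W ∈ 𝒟, W.Nonempty ∧ ∃ (S : Finset A) (t : A → Set ℝ),
      (∀ a, IsOpen (t a)) ∧ W = (S : Set A).pi t)
    (hdisj : 𝒟.PairwiseDisjoint id) : 𝒟.Countable := by
  let μ : Measure (A → ℝ) := Measure.infinitePi fun _ => gaussianReal 0 1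
  have hmeas : ∀ W : 𝒟, MeasurableSet (W : Set (A → ℝ)) := by
    rintro ⟨W, hW⟩
    obtain ⟨-, S, t, ht, rfl⟩ := hbox W hW
    exact MeasurableSet.pi S.countable_toSet fun a _ => (ht a).measurableSet
  have hcount := Measure.countable_meas_pos_of_disjoint_iUnion (μ := μ) hmeas
    (fun W W' hne => hdisj W.2 W'.2 fun h => hne (Subtype.ext h))
  have hall : {W : 𝒟 | 0 < μ (W : Set (A → ℝ))} = univ := by
    refine eq_univ_of_forall fun ⟨W, hW⟩ => ?_
    obtain ⟨⟨x, hx⟩, S, t, ht, rfl⟩ := hbox W hW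
    change 0 < μ ((S : Set A).pi t)
    rw [Measure.infinitePi_pi _ fun a _ => (ht a).measurableSet]
    refine CanonicallyOrderedAdd.prod_pos.2 fun a ha => pos_iff_ne_zero.2 fun h0 => ?_
    have h1 := gaussianReal_absolutelyContinuous' 0 (one_ne_zero (α := NNReal)) h0
    exact (ht a).measure_ne_zero volume ⟨x a, hx a ha⟩ h1
  rw [hall] at hcount
  exact Set.countable_coe_iff.1 (Set.countable_univ_iff.1 hcount)

open Classical in
/-- Overwrite the coordinates of `y` in `B` with those of `x`. -/
noncomputable def overwrite (B : Set A) (x y : A → ℝ) : A → ℝ := fun a => if a ∈ B then x a else y a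

theorem continuous_overwrite (B : Set A) (y : A → ℝ) : Continuous fun x => overwrite B x y := by
  refine continuous_pi fun a => ?_
  by_cases h : a ∈ B
  · simpa [overwrite, h] using continuous_apply a
  · simpa [overwrite, h] using continuous_const

theorem overwrite_of_mem {B : Set A} {a : A} (h : a ∈ B) (x y : A → ℝ) :
    overwrite B x y a = x a := by simp [overwrite, h]

theorem overwrite_of_notMem {B : Set A} {a : A} (h : a ∉ B) (x y : A → ℝ) :
    overwrite B x y a = y a := by simp [overwrite, h]

theorem overwrite_eq {B : Set A} {x y : A → ℝ} (h : ∀ b ∈ B, x b = y b) :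
    overwrite B x y = y := by
  funext a
  by_cases ha : a ∈ B
  · rw [overwrite_of_mem ha, h a ha]
  · rw [overwrite_of_notMem ha]

/-- The closure of an open subset of a power of `ℝ` is determined by countably many coordinates. -/
theorem exists_countable_closure {V : Set (A → ℝ)} (hV : IsOpen V) :
    ∃ B : Set A, B.Countable ∧
      ∀ x y, (∀ b ∈ B, x b = y b) → x ∈ closure V → y ∈ closure V := by
  let 𝓑 : Set (Set (A → ℝ)) := {W | W.Nonempty ∧ W ⊆ V ∧ ∃ (S : Finset A) (t : A → Set ℝ),
      (∀ a, IsOpen (t a)) ∧ W = (S : Set A).pi t}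
  obtain ⟨𝒟, h𝒟⟩ := zorn_subset {𝒟 | 𝒟 ⊆ 𝓑 ∧ 𝒟.PairwiseDisjoint id} (by
    intro c hc hchain
    refine ⟨⋃₀ c, ⟨sUnion_subset fun s hs => (hc hs).1, ?_⟩, fun s hs => subset_sUnion_of_mem hs⟩
    exact (pairwiseDisjoint_sUnion hchain.directedOn).2 fun s hs => (hc hs).2)
  obtain ⟨⟨hsub, hdisj⟩, hmax⟩ := h𝒟
  have hcount : 𝒟.Countable := countable_of_pairwiseDisjoint_boxes 𝒟
    (fun W hW => ⟨(hsub hW).1, (hsub hW).2.2⟩) hdisj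
  choose! S t ht hWS using fun W (hW : W ∈ 𝒟) => (hsub hW).2.2
  let B : Set A := ⋃ W ∈ 𝒟, (S W : Set A)
  have hdense : V ⊆ closure (⋃₀ 𝒟) := by
    intro x hx
    by_contra hcl
    have hopen : IsOpen (V ∩ (closure (⋃₀ 𝒟))ᶜ) := hV.inter isClosed_closure.isOpen_compl
    obtain ⟨I, u, hu, huV⟩ := isOpen_pi_iff.1 hopen x ⟨hx, hcl⟩
    classical
    let u' : A → Set ℝ := fun a => if a ∈ I then u a else univ
    have hI : (I : Set A).pi u' = (I : Set A).pi u :=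
      Set.pi_congr rfl fun a ha => if_pos ha
    have hxW : x ∈ (I : Set A).pi u := fun a ha => (hu a ha).2
    have hW : (I : Set A).pi u ∈ 𝓑 := by
      refine ⟨⟨x, hxW⟩, fun y hy => (huV hy).1, I, u', fun a => ?_, hI.symm⟩
      by_cases ha : a ∈ I
      · simpa [u', ha] using (hu a ha).1
      · simp [u', ha]
    have hdj : ∀ W ∈ 𝒟, Disjoint ((I : Set A).pi u) W := fun W hW =>
      Set.disjoint_left.2 fun y hy hyW => (huV hy).2 (subset_closure ⟨W, hW, hyW⟩)
    have hmem := hmax (y := insert ((I : Set A).pi u) 𝒟)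
      ⟨insert_subset hW hsub, hdisj.insert fun W hW _ => hdj W hW⟩ (subset_insert _ _)
      (mem_insert _ _)
    exact Set.disjoint_left.1 (hdj _ hmem) hxW hxW
  have hsubV : ⋃₀ 𝒟 ⊆ V := sUnion_subset fun W hW => (hsub hW).2.1
  have hcl : closure V = closure (⋃₀ 𝒟) :=
    (closure_minimal hdense isClosed_closure).antisymm (closure_mono hsubV)
  refine ⟨B, hcount.biUnion fun W _ => (S W).countable_toSet, fun x y hxy hx => ?_⟩
  rw [hcl] at hx ⊢
  rw [← overwrite_eq hxy]
  refine map_mem_closure (f := fun x => overwrite B x y) (continuous_overwrite B y) hx ?_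
  rintro w ⟨W, hW, hwW⟩
  refine ⟨W, hW, ?_⟩
  rw [hWS W hW] at hwW ⊢
  intro a ha
  have haB : a ∈ B := mem_biUnion hW ha
  simpa only [overwrite_of_mem haB] using hwW a ha

/-- A continuous real function on an open subset of a power of `ℝ` depends on countably many
coordinates. -/
theorem exists_countable_dependsOn {U : Set (A → ℝ)} (hU : IsOpen U) {f : (A → ℝ) → ℝ}
    (hf : ContinuousOn f U) :
    ∃ B : Set A, B.Countable ∧ ∀ x ∈ U, ∀ y ∈ U, (∀ b ∈ B, x b = y b) → f x = f y := by
  choose B hB hBcl using fun q : ℚ =>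
    exists_countable_closure (hf.isOpen_inter_preimage hU (isOpen_Iio (a := (q : ℝ))))
  refine ⟨⋃ q, B q, countable_iUnion hB, ?_⟩
  have key : ∀ x ∈ U, ∀ y ∈ U, (∀ b ∈ ⋃ q, B q, x b = y b) → ¬ f x < f y := by
    intro x hx y hy hxy hlt
    obtain ⟨q, hxq, hqy⟩ := exists_rat_btwn hlt
    have hycl := hBcl q x y (fun b hb => hxy b (mem_iUnion_of_mem q hb))
      (subset_closure ⟨hx, hxq⟩)
    have hopen := hf.isOpen_inter_preimage hU (isOpen_Ioi (a := (q : ℝ)))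
    obtain ⟨z, hz, hz'⟩ := mem_closure_iff.1 hycl _ hopen ⟨hy, hqy⟩
    exact lt_asymm (show f z < q from hz'.2) hz.2
  intro x hx y hy hxy
  exact le_antisymm (not_lt.1 (key y hy x hx fun b hb => (hxy b hb).symm))
    (not_lt.1 (key x hx y hy hxy))

/-- Continuous real functions extend from an open set meeting every coset of the subproducts of
countable codimension. -/
theorem exists_extension {U : Set (A → ℝ)} (hU : IsOpen U)
    (hGδ : ∀ B : Set A, B.Countable → ∀ x : A → ℝ, ∃ y ∈ U, ∀ b ∈ B, y b = x b)
    {f : (A → ℝ) → ℝ} (hf : ContinuousOn f U) :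
    ∃ g : (A → ℝ) → ℝ, Continuous g ∧ EqOn g f U := by
  obtain ⟨B, hB, hBf⟩ := exists_countable_dependsOn hU hf
  choose r hrU hr using hGδ B hB
  refine ⟨fun x => f (r x), continuous_iff_continuousAt.2 fun x => ?_,
    fun x hx => hBf _ (hrU x) _ hx (hr x)⟩
  have hx : overwrite B x (r x) = r x := overwrite_eq fun b hb => (hr x b hb).symm
  have hc := (continuous_overwrite B (r x)).continuousAt (x := x)
  have hfx : ContinuousAt f (overwrite B x (r x)) := by
    rw [hx]; exact hf.continuousAt (hU.mem_nhds (hrU x))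
  refine (ContinuousAt.comp (f := fun z => overwrite B z (r x)) hfx hc).congr ?_
  have hnear := hc.preimage_mem_nhds (hU.mem_nhds (hx.symm ▸ hrU x))
  filter_upwards [hnear] with z hz
  refine hBf _ hz _ (hrU z) fun b hb => ?_
  exact (overwrite_of_mem hb z (r x)).trans (hr z b hb).symm

theorem isCFOCover_slabs (b : A) (n : ℕ) :
    IsCFOCover (range fun q : ℚ => {x : A → ℝ | |x b - q| < 1 / (n + 1)}) := by
  refine ⟨countable_range _, ?_, ?_⟩
  · rintro _ ⟨q, rfl⟩
    refine ⟨fun x => max 0 (1 / (n + 1) - |x b - q|), by fun_prop, ?_⟩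
    ext x
    simp [-one_div]
  · refine eq_univ_of_forall fun x => ?_
    obtain ⟨q, hq⟩ := exists_rat_near (x b) (ε := 1 / ((n : ℝ) + 1)) (by positivity)
    exact ⟨_, ⟨q, rfl⟩, hq⟩

/-- The identity can be pushed off a `Z_τ`-set without moving fewer than `τ` given coordinates. -/
theorem exists_section {τ : Cardinal.{u}} (hτ : Cardinal.aleph0 < τ) {Z : Set (A → ℝ)}
    (hZ : ZTauSet τ Z) {B : Set A} (hB : Cardinal.mk B < τ) :
    ∃ f : (A → ℝ) → (A → ℝ), Continuous f ∧ (∀ x, ∀ b ∈ B, f x b = x b) ∧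
      FunctionallySeparated (range f) Z := by
  let cov : B × ULift.{u} ℕ → Set (Set (A → ℝ)) := fun p =>
    range fun q : ℚ => {x : A → ℝ | |x p.1 - q| < 1 / (p.2.down + 1)}
  obtain ⟨f, hf, hclose, hsep⟩ := hZ.2 id continuous_id (range cov)
    (Cardinal.mk_range_le.trans_lt (by
      simpa using Cardinal.mul_lt_of_lt hτ.le hB hτ))
    (by rintro _ ⟨p, rfl⟩; exact isCFOCover_slabs _ _)
  refine ⟨f, hf, fun x b hb => eq_of_forall_dist_le fun ε hε => ?_, hsep⟩
  obtain ⟨n, hn⟩ := exists_nat_one_div_lt (half_pos hε)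
  obtain ⟨_, ⟨q, rfl⟩, h1, h2⟩ := hclose _ ⟨(⟨b, hb⟩, ⟨n⟩), rfl⟩ x
  have h1' : |f x b - q| < 1 / (n + 1) := h1
  have h2' : |x b - q| < 1 / (n + 1) := h2
  rw [Real.dist_eq]
  rw [abs_lt] at h1' h2'
  rw [abs_le]
  constructor <;> linarith [h1'.1, h1'.2, h2'.1, h2'.2]

theorem exists_notMem_eqOn_countable {τ : Cardinal.{u}} (hτ : Cardinal.aleph0 < τ)
    {Z : Set (A → ℝ)} (hZ : ZTauSet τ Z) {B : Set A} (hB : B.Countable) (x : A → ℝ) :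
    ∃ y ∈ Zᶜ, ∀ b ∈ B, y b = x b := by
  obtain ⟨f, -, hfB, φ, -, -, h0, h1⟩ := exists_section hτ hZ
    ((Cardinal.le_aleph0_iff_set_countable.2 hB).trans_lt hτ)
  refine ⟨f x, fun hz => ?_, hfB x⟩
  have := h0 _ (mem_range_self x)
  rw [h1 _ hz] at this
  exact one_ne_zero this

theorem dense_compl {τ : Cardinal.{u}} (hτ : Cardinal.aleph0 < τ)
    {Z : Set (A → ℝ)} (hZ : ZTauSet τ Z) : Dense Zᶜ := by
  intro x
  refine mem_closure_iff.2 fun V hV hx => ?_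
  obtain ⟨I, u, hu, huV⟩ := isOpen_pi_iff.1 hV x hx
  obtain ⟨y, hy, hyx⟩ := exists_notMem_eqOn_countable hτ hZ I.countable_toSet x
  exact ⟨y, huV fun a ha => (hyx a ha).symm ▸ (hu a ha).2, hy⟩

/-- Maps from the complement of a closed `Z_τ`-set into a power of `ℝ` extend to the whole power. -/
theorem exists_extension_compl {τ : Cardinal.{u}} (hτ : Cardinal.aleph0 < τ)
    {Z : Set (A → ℝ)} (hZ : ZTauSet τ Z) {f : ↥Zᶜ → A → ℝ} (hf : Continuous f) :
    ∃ g : (A → ℝ) → (A → ℝ), Continuous g ∧ ∀ x : ↥Zᶜ, g x = f x := by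
  classical
  have key : ∀ a, ∃ g : (A → ℝ) → ℝ, Continuous g ∧ ∀ x : ↥Zᶜ, g x = f x a := by
    intro a
    let f' : (A → ℝ) → ℝ := fun x => if h : x ∈ Zᶜ then f ⟨x, h⟩ a else 0
    have hf' : Zᶜ.domRestrict f' = fun x => f x a := by
      funext x
      exact dif_pos x.2
    obtain ⟨g, hg, hgf⟩ := exists_extension hZ.1.isOpen_compl
      (fun B hB x => exists_notMem_eqOn_countable hτ hZ hB x)
      (f := f') (continuousOn_iff_continuous_domRestrict.2 (by
        rw [hf']; exact (continuous_apply a).comp hf))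
    exact ⟨g, hg, fun x => (hgf x.2).trans (congrFun hf' x)⟩
  choose g hg hgf using key
  exact ⟨fun x a => g a x, continuous_pi hg, fun x => funext fun a => hgf a x⟩

theorem extension_comp_eq {τ : Cardinal.{u}} (hτ : Cardinal.aleph0 < τ)
    {Z F : Set (A → ℝ)} (hZ : ZTauSet τ Z) (u : ↥Zᶜ ≃ₜ ↥Fᶜ) {g g' : (A → ℝ) → (A → ℝ)}
    (hg : Continuous g) (hg' : Continuous g') (hgu : ∀ x : ↥Zᶜ, g x = u x)
    (hgu' : ∀ x : ↥Fᶜ, g' x = u.symm x) (x : A → ℝ) : g' (g x) = x := by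
  have h : g' ∘ g = id := (hg'.comp hg).ext_on (dense_compl hτ hZ) continuous_id fun x hx => by
    rw [Function.comp_apply, hgu ⟨x, hx⟩, hgu', u.symm_apply_apply, id]
  exact congrFun h x

/-- Homeomorphic complements of closed `Z_τ`-sets come from a homeomorphism of pairs. -/
theorem nonempty_homeomorph_of_compl {τ : Cardinal.{u}} (hτ : Cardinal.aleph0 < τ)
    {Z F : Set (A → ℝ)} (hZ : ZTauSet τ Z) (hF : ZTauSet τ F) (u : ↥Zᶜ ≃ₜ ↥Fᶜ) :
    Nonempty (↥Z ≃ₜ ↥F) := by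
  obtain ⟨g, hg, hgu⟩ := exists_extension_compl hτ hZ (continuous_subtype_val.comp u.continuous)
  obtain ⟨g', hg', hgu'⟩ :=
    exists_extension_compl hτ hF (continuous_subtype_val.comp u.symm.continuous)
  let e : (A → ℝ) ≃ₜ (A → ℝ) :=
    { toFun := g
      invFun := g'
      left_inv := extension_comp_eq hτ hZ u hg hg' hgu hgu'
      right_inv := extension_comp_eq hτ hF u.symm hg' hg hgu' hgu
      continuous_toFun := hg
      continuous_invFun := hg' }
  refine ⟨e.sets ?_⟩
  have hZF : ∀ x ∈ Zᶜ, g x ∈ Fᶜ := fun x hx => (hgu ⟨x, hx⟩).symm ▸ (u ⟨x, hx⟩).2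
  have hFZ : ∀ x ∈ Fᶜ, g' x ∈ Zᶜ := fun x hx => (hgu' ⟨x, hx⟩).symm ▸ (u.symm ⟨x, hx⟩).2
  ext x
  rw [mem_preimage, ← not_iff_not]
  exact ⟨hZF x, fun hx => (e.left_inv x : g' (g x) = x) ▸ hFZ _ hx⟩

/-- A homeomorphism between closed C-embedded sets extends once both sets have been straightened
into the first factor of a square. -/
theorem exists_homeomorph_extension {Z F : Set (A → ℝ)} (hZC : CEmbedded Z) (hFC : CEmbedded F)
    (eZ eF : (A → ℝ) ≃ₜ (A → ℝ) × (A → ℝ)) (heZ : ∀ z ∈ Z, (eZ z).2 = 0)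
    (heF : ∀ z ∈ F, (eF z).2 = 0) (h : ↥Z ≃ₜ ↥F) :
    ∃ T : (A → ℝ) ≃ₜ (A → ℝ), ∀ z : ↥Z, T z = h z := by
  have extend : ∀ {Z' F' : Set (A → ℝ)}, CEmbedded Z' → ∀ e e' : (A → ℝ) ≃ₜ (A → ℝ) × (A → ℝ),
      (∀ z ∈ Z', (e z).2 = 0) → ∀ k : ↥Z' ≃ₜ ↥F', ∃ p : (A → ℝ) → (A → ℝ), Continuous p ∧
        ∀ z : ↥Z', p (e z).1 = (e' (k z)).1 := by
    intro Z' F' hC e e' he k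
    choose ψ hψ hψk using fun a => hC (fun z => (e' (k z)).1 a) (by fun_prop)
    refine ⟨fun w a => ψ a (e.symm (w, 0)), by fun_prop, fun z => funext fun a => ?_⟩
    have hz : ((e z).1, (0 : A → ℝ)) = e z := Prod.ext rfl (he z z.2).symm
    change ψ a (e.symm ((e z).1, 0)) = _
    rw [hz, e.symm_apply_apply, hψk]
  obtain ⟨p, hp, hpz⟩ := extend hZC eZ eF heZ h
  obtain ⟨q, hq, hqz⟩ := extend hFC eF eZ heF h.symm
  let S : (A → ℝ) × (A → ℝ) ≃ₜ (A → ℝ) × (A → ℝ) :=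
    { toFun := fun w => (w.2 + p w.1, w.1 - q (w.2 + p w.1))
      invFun := fun w => (w.2 + q w.1, w.1 - p (w.2 + q w.1))
      left_inv := fun w => by ext <;> simp
      right_inv := fun w => by ext <;> simp
      continuous_toFun := by fun_prop
      continuous_invFun := by fun_prop }
  refine ⟨(eZ.trans S).trans eF.symm, fun z => ?_⟩
  change eF.symm (S (eZ z)) = h z
  rw [Homeomorph.symm_apply_eq]
  have hq' := hqz (h z)
  rw [h.symm_apply_apply, ← hpz] at hq'
  have h2 := heZ z z.2
  refine Prod.ext ?_ ?_
  · simp [S, h2, hpz]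
  · simp [S, h2, hq', heF]

/-- If `φ` vanishes on the graph of `σ`, then the set `{φ = 1}` can be fibrewise bounded along rays
issuing from `σ`. -/
theorem exists_ray_bound {σ : (A → ℝ) → (A → ℝ)} (hσ : Continuous σ) {φ : (A → ℝ) → ℝ}
    (hφ : Continuous φ) (h0 : ∀ y, φ (σ y) = 0) {B C : Set A}
    (hσdep : ∀ y y', (∀ b ∈ B, y b = y' b) → σ y = σ y')
    (hφC : ∀ y y', (∀ c ∈ C, y c = y' c) → φ y = φ y') :
    ∃ κ : (A → ℝ) → ℝ, Continuous κ ∧ (∀ y, 0 ≤ κ y) ∧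
      (∀ y y', (∀ c ∈ B ∪ C, y c = y' c) → κ y = κ y') ∧
      ∀ y, ∀ r : ℝ, 0 ≤ r → φ (σ y + (1 + r)⁻¹ • (y - σ y)) = 1 → r ≤ κ y := by
  let m : (A → ℝ) → ℝ → (A → ℝ) := fun y s => σ y + s • (y - σ y)
  let k : (A → ℝ) → ℝ → ℝ := fun y s => (s⁻¹ - 1) * max 0 (2 * φ (m y s) - 1)
  have hm : Continuous fun p : (A → ℝ) × ℝ => m p.1 p.2 := by fun_prop
  have hk : Continuous fun p : (A → ℝ) × ℝ => k p.1 p.2 := by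
    refine continuous_iff_continuousAt.2 fun ⟨y, s⟩ => ?_
    by_cases hs : s = 0
    · subst hs
      have hlt : φ (m y 0) < 1 / 2 := by simp [m, h0]
      have hev := (hφ.comp hm).continuousAt (x := (y, (0 : ℝ))) |>.eventually_lt_const hlt
      refine (continuousAt_const (y := (0 : ℝ))).congr ?_
      filter_upwards [hev] with p hp
      have hp' : φ (m p.1 p.2) < 1 / 2 := hp
      simp only [k]
      rw [max_eq_left (by linarith), mul_zero]
    · have h1 : ContinuousAt (fun p : (A → ℝ) × ℝ => p.2⁻¹) (y, s) :=
        continuousAt_snd.inv₀ hs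
      have h2 : ContinuousAt (fun p : (A → ℝ) × ℝ => max 0 (2 * φ (m p.1 p.2) - 1)) (y, s) :=
        (continuous_const.max
          (((hφ.comp hm).const_mul 2).sub continuous_const)).continuousAt
      exact (h1.sub continuousAt_const).mul h2
  have hkdep : ∀ y y', (∀ c ∈ B ∪ C, y c = y' c) → k y = k y' := by
    intro y y' hyy'
    funext s
    have hs := hσdep y y' fun b hb => hyy' b (Or.inl hb)
    simp only [k]
    rw [hφC (m y s) (m y' s) fun c hc => by simp [m, hs, hyy' c (Or.inr hc)]]
  have hcont : ∀ y, Continuous (k y) := fun y => hk.comp (Continuous.prodMk_right y)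
  have hbdd : ∀ y, BddAbove (k y '' Icc 0 1) := fun y =>
    (isCompact_Icc.image (hcont y)).bddAbove
  have hknn : ∀ y, ∀ s ∈ Icc (0 : ℝ) 1, 0 ≤ k y s := by
    intro y s hs
    rcases hs.1.eq_or_lt with h | h
    · simp [k, ← h, m, h0]
    · exact mul_nonneg (sub_nonneg.2 ((one_le_inv₀ h).2 hs.2)) (le_max_left _ _)
  refine ⟨fun y => sSup (k y '' Icc 0 1), isCompact_Icc.continuous_sSup hk, fun y => ?_,
    fun y y' h => by simp only [hkdep y y' h], fun y r hr h1 => ?_⟩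
  · exact (hknn y 0 (by simp)).trans (le_csSup (hbdd y) ⟨0, by simp, rfl⟩)
  · have hr' : (1 : ℝ) ≤ 1 + r := by linarith
    refine le_csSup (hbdd y) ⟨(1 + r)⁻¹, ⟨by positivity, inv_le_one_of_one_le₀ hr'⟩, ?_⟩
    simp only [k, m, h1, inv_inv]
    norm_num

/-- `G` and `G'` are mutually inverse self-homeomorphisms of a power of `ℝ` which only change the
coordinates in `D`, in a way that depends on the coordinates in `B ∪ D`. -/
structure IsBlockHomeo (B D : Set A) (G G' : (A → ℝ) → (A → ℝ)) : Prop where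
  continuous : Continuous G
  continuous_inv : Continuous G'
  left_inv : ∀ y, G' (G y) = y
  right_inv : ∀ y, G (G' y) = y
  apply_of_notMem : ∀ y, ∀ a ∉ D, G y a = y a
  dep : ∀ y y', (∀ a ∈ B ∪ D, y a = y' a) → ∀ a ∈ D, G y a = G y' a
  dep_inv : ∀ y y', (∀ a ∈ B ∪ D, y a = y' a) → ∀ a ∈ D, G' y a = G' y' a

theorem IsBlockHomeo.inv_apply_of_notMem {B D : Set A} {G G' : (A → ℝ) → (A → ℝ)}
    (h : IsBlockHomeo B D G G') (y : A → ℝ) {a : A} (ha : a ∉ D) : G' y a = y a := by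
  rw [← h.apply_of_notMem (G' y) a ha, h.right_inv]

/-- Away from any small set of coordinates, a `Z_τ`-set can be moved so that one of its coordinates
becomes bounded. -/
theorem exists_isBlockHomeo {τ : Cardinal.{u}} (hτ : Cardinal.aleph0 < τ)
    (hA : Cardinal.mk A = τ) {Z : Set (A → ℝ)}
    (hZ : ZTauSet τ Z) {B : Set A} (hB : Cardinal.mk B < τ) :
    ∃ D : Set A, D.Countable ∧ Disjoint D B ∧ ∃ x ∈ D, ∃ G G' : (A → ℝ) → (A → ℝ),
      IsBlockHomeo B D G G' ∧ ∀ z ∈ Z, |G z x| ≤ 1 := by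
  classical
  obtain ⟨f, hf, hfB, φ, hφ, -, hφ0, hφ1⟩ := exists_section hτ hZ hB
  obtain ⟨C₀, hC₀, hφC⟩ := exists_countable_dependsOn isOpen_univ hφ.continuousOn
  let C := C₀ \ B
  have hC : C.Countable := hC₀.mono sdiff_subset
  obtain ⟨x, hx⟩ : ∃ x, x ∉ B ∪ C := by
    by_contra! h
    have h1 : Cardinal.mk ↥(B ∪ C) < τ := (Cardinal.mk_union_le _ _).trans_lt
      (Cardinal.add_lt_of_lt hτ.le hB ((Cardinal.le_aleph0_iff_set_countable.2 hC).trans_lt hτ))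
    rw [eq_univ_of_forall h, Cardinal.mk_univ, hA] at h1
    exact lt_irrefl _ h1
  have hxC : x ∉ C := fun h => hx (Or.inr h)
  have hxB : x ∉ B := fun h => hx (Or.inl h)
  let σ : (A → ℝ) → (A → ℝ) := fun y => f (overwrite B y 0)
  have hσ : Continuous σ := hf.comp (continuous_overwrite B 0)
  have hσB : ∀ y, ∀ b ∈ B, σ y b = y b := fun y b hb => by
    simp only [σ]; rw [hfB _ b hb, overwrite_of_mem hb]
  have hσdep : ∀ y y', (∀ b ∈ B, y b = y' b) → σ y = σ y' := fun y y' h => by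
    have : overwrite B y 0 = overwrite B y' 0 := by
      funext a
      by_cases ha : a ∈ B
      · rw [overwrite_of_mem ha, overwrite_of_mem ha, h a ha]
      · rw [overwrite_of_notMem ha, overwrite_of_notMem ha]
    simp only [σ, this]
  obtain ⟨κ, hκ, hκ0, hκdep, hκr⟩ := exists_ray_bound hσ hφ
    (fun y => hφ0 _ (mem_range_self _)) hσdep
    (fun y y' h => hφC y (mem_univ _) y' (mem_univ _) h)
  have hBC : ∀ a ∈ B ∪ C₀, a ∉ C → a ∈ B := fun a ha haC =>
    ha.elim id fun h => by_contra fun hB => haC ⟨h, hB⟩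
  have hneC : ∀ a ∈ C, a ≠ x := fun a ha h => hxC (h ▸ ha)
  let P : (A → ℝ) → (A → ℝ) := fun y a =>
    if a ∈ C then σ y a + (1 + |y x|) * (y a - σ y a) else y a
  let G : (A → ℝ) → (A → ℝ) := fun y a => if a = x then y x / (1 + κ (P y)) else P y a
  let X : (A → ℝ) → ℝ := fun y => y x * (1 + κ y)
  let G' : (A → ℝ) → (A → ℝ) := fun y a =>
    if a = x then X y else if a ∈ C then σ y a + (1 + |X y|)⁻¹ * (y a - σ y a) else y a
  have hκ1 : ∀ y, 1 + κ y ≠ 0 := fun y => (by linarith [hκ0 y] : 0 < 1 + κ y).ne'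
  have habs : ∀ r : ℝ, 1 + |r| ≠ 0 := fun r => by positivity
  have hP : Continuous P := by
    refine continuous_pi fun a => ?_
    by_cases ha : a ∈ C
    · simp only [P, ha, if_true]; fun_prop
    · simp only [P, ha, if_false]; fun_prop
  have hX : Continuous X := by fun_prop
  have hPC : ∀ y, ∀ a ∈ C, P y a = σ y a + (1 + |y x|) * (y a - σ y a) :=
    fun y a ha => if_pos ha
  have hPB : ∀ y, ∀ a ∉ C, P y a = y a := fun y a ha => if_neg ha
  have hGx : ∀ y, G y x = y x / (1 + κ (P y)) := fun y => if_pos rfl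
  have hGP : ∀ y, ∀ a ≠ x, G y a = P y a := fun y a ha => if_neg ha
  have hG'x : ∀ y, G' y x = X y := fun y => if_pos rfl
  have hG'C : ∀ y, ∀ a ∈ C, G' y a = σ y a + (1 + |X y|)⁻¹ * (y a - σ y a) := fun y a ha => by
    simp only [G']; rw [if_neg (hneC a ha), if_pos ha]
  have hG'o : ∀ y, ∀ a ≠ x, a ∉ C → G' y a = y a := fun y a ha haC => by
    simp only [G']; rw [if_neg ha, if_neg haC]
  have hneB : ∀ a ∈ B ∪ C₀, a ≠ x := fun a ha h => by
    by_cases haC : a ∈ C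
    · exact hneC a haC h
    · exact hxB (h ▸ hBC a ha haC)
  have hBnC : ∀ b ∈ B, b ∉ C := fun b hb h => h.2 hb
  have hBne : ∀ b ∈ B, b ≠ x := fun b hb h => hxB (h ▸ hb)
  have hσG : ∀ y, σ (G y) = σ y := fun y => hσdep _ _ fun b hb => by
    rw [hGP _ _ (hBne b hb), hPB _ _ (hBnC b hb)]
  have hσG' : ∀ y, σ (G' y) = σ y := fun y => hσdep _ _ fun b hb =>
    hG'o _ _ (hBne b hb) (hBnC b hb)
  have hσP : ∀ y, σ (P y) = σ y := fun y => hσdep _ _ fun b hb => hPB _ _ (hBnC b hb)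
  have hκG : ∀ y, κ (G y) = κ (P y) := fun y => hκdep _ _ fun c hc => hGP _ _ (hneB c hc)
  have hXG : ∀ y, X (G y) = y x := fun y => by
    simp only [X]
    rw [hκG, hGx, div_mul_cancel₀ _ (hκ1 _)]
  have hκPG' : ∀ y, κ (P (G' y)) = κ y := fun y => hκdep _ _ fun c hc => by
    by_cases hcC : c ∈ C
    · rw [hPC _ _ hcC, hσG', hG'x, hG'C _ _ hcC, add_sub_cancel_left,
        mul_inv_cancel_left₀ (habs _), add_sub_cancel]
    · rw [hPB _ _ hcC, hG'o _ _ (hneB c hc) hcC]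
  refine ⟨insert x C, hC.insert x, ?_, x, mem_insert _ _, G, G', ?_, ?_⟩
  · rw [Set.disjoint_left]
    rintro a (rfl | ha)
    · exact hxB
    · exact ha.2
  · refine ⟨?_, ?_, ?_, ?_, ?_, ?_, ?_⟩
    · refine continuous_pi fun a => ?_
      by_cases ha : a = x
      · simp only [G, ha, if_true]
        exact (continuous_apply x).div (continuous_const.add (hκ.comp hP)) fun y => hκ1 _
      · simp only [G, ha, if_false]; fun_prop
    · refine continuous_pi fun a => ?_
      by_cases ha : a = x
      · simp only [G', ha, if_true]; exact hX
      · by_cases haC : a ∈ C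
        · simp only [G', ha, haC, if_true, if_false]
          have : Continuous fun y => (1 + |X y|)⁻¹ :=
            (continuous_const.add hX.abs).inv₀ fun y => habs _
          fun_prop
        · simp only [G', ha, haC, if_false]; fun_prop
    · intro y
      funext a
      by_cases ha : a = x
      · rw [ha, hG'x, hXG]
      · by_cases haC : a ∈ C
        · rw [hG'C _ _ haC, hXG, hσG, hGP _ _ ha, hPC _ _ haC, add_sub_cancel_left,
            inv_mul_cancel_left₀ (habs _), add_sub_cancel]
        · rw [hG'o _ _ ha haC, hGP _ _ ha, hPB _ _ haC]
    · intro y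
      funext a
      by_cases ha : a = x
      · rw [ha, hGx, hκPG', hG'x]
        exact mul_div_cancel_right₀ _ (hκ1 _)
      · by_cases haC : a ∈ C
        · rw [hGP _ _ ha, hPC _ _ haC, hσG', hG'x, hG'C _ _ haC, add_sub_cancel_left,
            mul_inv_cancel_left₀ (habs _), add_sub_cancel]
        · rw [hGP _ _ ha, hPB _ _ haC, hG'o _ _ ha haC]
    · intro y a ha
      rw [hGP _ _ fun h => ha (Or.inl h), hPB _ _ fun h => ha (Or.inr h)]
    · intro y y' h a ha
      have hs := hσdep y y' fun b hb => h b (Or.inl hb)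
      have hx' := h x (Or.inr (Or.inl rfl))
      have hP' : ∀ c ∈ B ∪ C₀, P y c = P y' c := fun c hc => by
        by_cases hcC : c ∈ C
        · rw [hPC _ _ hcC, hPC _ _ hcC, hs, hx', h c (Or.inr (Or.inr hcC))]
        · rw [hPB _ _ hcC, hPB _ _ hcC, h c (Or.inl (hBC c hc hcC))]
      by_cases hax : a = x
      · rw [hax, hGx, hGx, hx', hκdep _ _ hP']
      · have haC : a ∈ C := ha.resolve_left hax
        rw [hGP _ _ hax, hGP _ _ hax, hP' a (Or.inr haC.1)]
    · intro y y' h a ha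
      have hs := hσdep y y' fun b hb => h b (Or.inl hb)
      have hX' : X y = X y' := by
        simp only [X]
        rw [h x (Or.inr (Or.inl rfl)), hκdep y y' fun c hc => ?_]
        by_cases hcC : c ∈ C
        · exact h c (Or.inr (Or.inr hcC))
        · exact h c (Or.inl (hBC c hc hcC))
      by_cases hax : a = x
      · rw [hax, hG'x, hG'x, hX']
      · have haC : a ∈ C := ha.resolve_left hax
        rw [hG'C _ _ haC, hG'C _ _ haC, hs, hX', h a (Or.inr (Or.inr haC))]
  · intro z hz
    have hle : |z x| ≤ κ (P z) := by
      refine hκr (P z) |z x| (abs_nonneg _) ?_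
      refine Eq.trans ?_ (hφ1 z hz)
      refine hφC _ (mem_univ _) _ (mem_univ _) fun c hc => ?_
      rw [hσP]
      simp only [Pi.add_apply, Pi.smul_apply, Pi.sub_apply, smul_eq_mul]
      by_cases hcC : c ∈ C
      · rw [hPC _ _ hcC, add_sub_cancel_left, inv_mul_cancel_left₀ (habs _), add_sub_cancel]
      · rw [hPB _ _ hcC, hσB _ _ (hBC c (Or.inr hc) hcC)]
        ring
    rw [hGx, abs_div, abs_of_pos (by linarith [hκ0 (P z)] : 0 < 1 + κ (P z)),
      div_le_one (by linarith [hκ0 (P z)])]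
    linarith

/-- A well-ordered family of block homeomorphisms, each one depending only on its own block and the
earlier ones, assembles to a homeomorphism. -/
theorem exists_homeomorph_of_blocks {ι : Type*} [LinearOrder ι] [WellFoundedLT ι]
    {D : ι → Set A} {G G' : ι → (A → ℝ) → (A → ℝ)}
    (hD : ∀ β, Disjoint (D β) (⋃ γ ∈ Iio β, D γ))
    (hG : ∀ β, IsBlockHomeo (⋃ γ ∈ Iio β, D γ) (D β) (G β) (G' β)) :
    ∃ T : (A → ℝ) ≃ₜ (A → ℝ), ∀ y β, ∀ a ∈ D β, T y a = G β y a := by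
  classical
  have hmem : ∀ {β γ : ι} {a : A}, γ < β → a ∈ D γ → a ∈ ⋃ γ ∈ Iio β, D γ :=
    fun h ha => mem_biUnion (mem_Iio.2 h) ha
  have hlt : ∀ {β γ : ι} {a : A}, a ∈ D β → a ∈ D γ → ¬ γ < β := fun hβ hγ h =>
    Set.disjoint_left.1 (hD _) hβ (hmem h hγ)
  have huniq : ∀ {β γ : ι} {a : A}, a ∈ D β → a ∈ D γ → γ = β := fun hβ hγ =>
    le_antisymm (not_lt.1 (hlt hγ hβ)) (not_lt.1 (hlt hβ hγ))
  let H : (A → ℝ) → (A → ℝ) := fun y a => if h : ∃ β, a ∈ D β then G h.choose y a else y a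
  have hH : ∀ y β, ∀ a ∈ D β, H y a = G β y a := fun y β a ha => by
    have h : ∃ β, a ∈ D β := ⟨β, ha⟩
    simp only [H, dif_pos h]
    rw [huniq ha h.choose_spec]
  have hH0 : ∀ y a, (¬ ∃ β, a ∈ D β) → H y a = y a := fun y a h => dif_neg h
  -- `w β z` recovers the original coordinates in the blocks before `β`
  let step : (β : ι) → ((γ : ι) → γ < β → (A → ℝ) → (A → ℝ)) → (A → ℝ) → (A → ℝ) :=
    fun β w z a => if h : ∃ γ, γ < β ∧ a ∈ D γ then
      G' h.choose (w h.choose h.choose_spec.1 z) a else z a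
  let w : ι → (A → ℝ) → (A → ℝ) := wellFounded_lt.fix step
  have hweq : ∀ β, w β = step β fun γ _ => w γ := fun β => wellFounded_lt.fix_eq step β
  have hw : ∀ z β γ, γ < β → ∀ a ∈ D γ, w β z a = G' γ (w γ z) a := fun z β γ hγ a ha => by
    have h : ∃ γ, γ < β ∧ a ∈ D γ := ⟨γ, hγ, ha⟩
    rw [hweq]
    simp only [step, dif_pos h]
    rw [huniq ha h.choose_spec.2]
  have hw0 : ∀ z β a, (¬ ∃ γ, γ < β ∧ a ∈ D γ) → w β z a = z a := fun z β a h => by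
    rw [hweq]
    exact dif_neg h
  have hwcont : ∀ β, Continuous (w β) := fun β => by
    induction β using WellFoundedLT.induction with
    | ind β ih =>
      refine continuous_pi fun a => ?_
      by_cases h : ∃ γ, γ < β ∧ a ∈ D γ
      · obtain ⟨γ, hγ, ha⟩ := h
        simp only [hw _ _ _ hγ a ha]
        exact (continuous_apply a).comp ((hG γ).continuous_inv.comp (ih γ hγ))
      · simp only [hw0 _ _ a h]
        exact continuous_apply a
  let K : (A → ℝ) → (A → ℝ) := fun z a =>
    if h : ∃ β, a ∈ D β then G' h.choose (w h.choose z) a else z a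
  have hK : ∀ z β, ∀ a ∈ D β, K z a = G' β (w β z) a := fun z β a ha => by
    have h : ∃ β, a ∈ D β := ⟨β, ha⟩
    simp only [K, dif_pos h]
    rw [huniq ha h.choose_spec]
  have hK0 : ∀ z a, (¬ ∃ β, a ∈ D β) → K z a = z a := fun z a h => dif_neg h
  have hwD : ∀ z β, ∀ a ∈ D β, w β z a = z a := fun z β a ha =>
    hw0 z β a fun ⟨γ, hγ, haγ⟩ => hlt ha haγ hγ
  have hBD : ∀ {β : ι} {a : A}, (a ∈ ⋃ γ ∈ Iio β, D γ) → a ∉ D β := fun ha h =>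
    Set.disjoint_left.1 (hD _) h ha
  have hwH : ∀ y β, ∀ a ∈ ⋃ γ ∈ Iio β, D γ, w β (H y) a = y a := fun y β => by
    induction β using WellFoundedLT.induction with
    | ind β ih =>
      intro a ha
      simp only [mem_iUnion, mem_Iio, exists_prop] at ha
      obtain ⟨γ, hγ, haγ⟩ := ha
      rw [hw _ _ _ hγ a haγ, (hG γ).dep_inv (w γ (H y)) (G γ y) ?_ a haγ, (hG γ).left_inv]
      rintro b (hb | hb)
      · rw [ih γ hγ b hb, (hG γ).apply_of_notMem y b (hBD hb)]
      · rw [hwD _ _ b hb, hH _ _ b hb]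
  let T : (A → ℝ) ≃ₜ (A → ℝ) :=
    { toFun := H
      invFun := K
      left_inv := fun y => by
        funext a
        by_cases h : ∃ β, a ∈ D β
        · obtain ⟨β, ha⟩ := h
          rw [hK _ β a ha, (hG β).dep_inv (w β (H y)) (G β y) ?_ a ha, (hG β).left_inv]
          rintro b (hb | hb)
          · rw [hwH y β b hb, (hG β).apply_of_notMem y b (hBD hb)]
          · rw [hwD _ _ b hb, hH _ _ b hb]
        · rw [hK0 _ a h, hH0 _ a h]
      right_inv := fun z => by
        funext a
        by_cases h : ∃ β, a ∈ D β
        · obtain ⟨β, ha⟩ := h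
          rw [hH _ β a ha, (hG β).dep (K z) (G' β (w β z)) ?_ a ha, (hG β).right_inv, hwD _ _ a ha]
          rintro b (hb | hb)
          · rw [(hG β).inv_apply_of_notMem _ (hBD hb)]
            simp only [mem_iUnion, mem_Iio, exists_prop] at hb
            obtain ⟨γ, hγ, hbγ⟩ := hb
            rw [hK _ γ b hbγ, hw _ _ _ hγ b hbγ]
          · rw [hK _ _ b hb]
        · rw [hH0 _ a h, hK0 _ a h]
      continuous_toFun := continuous_pi fun a => by
        by_cases h : ∃ β, a ∈ D β
        · obtain ⟨β, ha⟩ := h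
          simp only [hH _ β a ha]
          exact (continuous_apply a).comp (hG β).continuous
        · simp only [hH0 _ a h]
          exact continuous_apply a
      continuous_invFun := continuous_pi fun a => by
        by_cases h : ∃ β, a ∈ D β
        · obtain ⟨β, ha⟩ := h
          simp only [hK _ β a ha]
          exact (continuous_apply a).comp ((hG β).continuous_inv.comp (hwcont β))
        · simp only [hK0 _ a h]
          exact continuous_apply a }
  exact ⟨T, hH⟩

/-- A `Z_τ`-set can be moved so that `τ` many of its coordinates become bounded. -/
theorem exists_homeomorph_bounded {τ : Cardinal.{u}} (hτ : Cardinal.aleph0 < τ)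
    (hA : Cardinal.mk A = τ) {Z : Set (A → ℝ)} (hZ : ZTauSet τ Z) :
    ∃ T : (A → ℝ) ≃ₜ (A → ℝ), ∃ E : Set A, Cardinal.mk E = τ ∧
      ∀ z ∈ Z, ∀ a ∈ E, |T z a| ≤ 1 := by
  have : Nonempty A := Cardinal.mk_ne_zero_iff.1 (hA ▸ (Cardinal.aleph0_pos.trans hτ).ne')
  choose! Φ hΦc hΦdisj x hxΦ G G' hG hbound using fun (B : Set A) (hB : Cardinal.mk B < τ) =>
    exists_isBlockHomeo hτ hA hZ hB
  let ι := τ.ord.ToType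
  let step : (β : ι) → ((γ : ι) → γ < β → Set A) → Set A :=
    fun β D => Φ (⋃ γ, ⋃ h : γ ∈ Iio β, D γ h)
  let D : ι → Set A := wellFounded_lt.fix step
  let B : ι → Set A := fun β => ⋃ γ ∈ Iio β, D γ
  have hDB : ∀ β, D β = Φ (B β) := fun β => wellFounded_lt.fix_eq step β
  have hBlt : ∀ β, Cardinal.mk (B β) < τ := fun β => by
    induction β using WellFoundedLT.induction with
    | ind β ih =>
      refine (Cardinal.mk_biUnion_le D (Iio β)).trans_lt
        (Cardinal.mul_lt_of_lt hτ.le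
          ((Cardinal.mk_Iio_lt β (by simp [ι])).trans_eq (Cardinal.mk_ord_toType τ))
          (lt_of_le_of_lt ?_ hτ))
      refine ciSup_le' fun γ => Cardinal.le_aleph0_iff_set_countable.2 ?_
      rw [hDB]
      exact hΦc _ (ih γ γ.2)
  have hdisj : ∀ β, Disjoint (D β) (B β) := fun β => hDB β ▸ hΦdisj _ (hBlt β)
  obtain ⟨T, hT⟩ := exists_homeomorph_of_blocks hdisj
    (G := fun β => G (B β)) (G' := fun β => G' (B β)) fun β => by
      have := hG _ (hBlt β)
      rwa [← hDB] at this
  have hxD : ∀ β, x (B β) ∈ D β := fun β => (hDB β).symm ▸ hxΦ _ (hBlt β)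
  have hne : ∀ β γ, γ < β → x (B β) ≠ x (B γ) := fun β γ hγ h =>
    Set.disjoint_left.1 (hdisj β) (hxD β) (h ▸ mem_biUnion (mem_Iio.2 hγ) (hxD γ))
  have hinj : Function.Injective fun β => x (B β) := fun β γ h => by
    rcases lt_trichotomy β γ with hlt | heq | hlt
    · exact absurd h.symm (hne γ β hlt)
    · exact heq
    · exact absurd h (hne β γ hlt)
  refine ⟨T, range fun β => x (B β), ?_, ?_⟩
  · rw [Cardinal.mk_range_eq _ hinj, Cardinal.mk_ord_toType]
  · rintro z hz _ ⟨β, rfl⟩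
    rw [hT z β _ (hxD β)]
    exact hbound _ (hBlt β) z hz

/-- A continuous function on `ℝ^ω` that computes limits of sequences whose increments are bounded
by `2 * 2⁻ⁿ`. -/
noncomputable def clampedLimit (x : ℕ → ℝ) : ℝ :=
  x 0 + ∑' n, max (-(2 * (1 / 2) ^ n)) (min (2 * (1 / 2) ^ n) (x (n + 1) - x n))

theorem continuous_clampedLimit : Continuous clampedLimit := by
  refine (continuous_apply 0).add (continuous_tsum (u := fun n : ℕ => 2 * (1 / 2 : ℝ) ^ n)
    (fun n => by fun_prop) (summable_geometric_two.mul_left 2) fun n x => ?_)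
  have h : (0 : ℝ) ≤ 2 * (1 / 2) ^ n := by positivity
  rw [Real.norm_eq_abs, abs_le]
  exact ⟨le_max_left _ _, max_le (by linarith) (min_le_left _ _)⟩

theorem clampedLimit_eq {x : ℕ → ℝ} (hx : ∀ n, |x n| ≤ 1) (t : ℝ) :
    clampedLimit (fun n => (1 / 2) ^ n * x n + t) = t := by
  have hclamp : ∀ n : ℕ, max (-(2 * (1 / 2) ^ n)) (min (2 * (1 / 2) ^ n)
      (((1 / 2) ^ (n + 1) * x (n + 1) + t) - ((1 / 2) ^ n * x n + t))) =
      (1 / 2) ^ (n + 1) * x (n + 1) - (1 / 2 : ℝ) ^ n * x n := by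
    intro n
    have h : (0 : ℝ) < (1 / 2) ^ n := by positivity
    obtain ⟨h1, h2⟩ := abs_le.1 (hx n)
    obtain ⟨h3, h4⟩ := abs_le.1 (hx (n + 1))
    rw [pow_succ, min_eq_right (by nlinarith), max_eq_right (by nlinarith)]
    ring
  have hlim : Filter.Tendsto (fun n : ℕ => (1 / 2 : ℝ) ^ n * x n) Filter.atTop (𝓝 0) := by
    refine squeeze_zero_norm (fun n => ?_)
      (tendsto_pow_atTop_nhds_zero_of_lt_one (r := (1 / 2 : ℝ)) (by norm_num) (by norm_num))
    rw [norm_mul, Real.norm_eq_abs (x n), norm_pow, Real.norm_of_nonneg (by norm_num)]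
    exact mul_le_of_le_one_right (by positivity) (hx n)
  have hsum : Summable fun n : ℕ =>
      (1 / 2) ^ (n + 1) * x (n + 1) - (1 / 2 : ℝ) ^ n * x n := by
    refine Summable.of_norm_bounded (g := fun n : ℕ => 2 * (1 / 2 : ℝ) ^ n)
      (summable_geometric_two.mul_left 2) fun n => ?_
    rw [← hclamp n, Real.norm_eq_abs, abs_le]
    have h : (0 : ℝ) ≤ 2 * (1 / 2) ^ n := by positivity
    exact ⟨le_max_left _ _, max_le (by linarith) (min_le_left _ _)⟩
  have htel := hsum.hasSum.tendsto_sum_nat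
  simp only [Finset.sum_range_sub (fun n : ℕ => (1 / 2 : ℝ) ^ n * x n)] at htel
  have hval := tendsto_nhds_unique htel (hlim.sub_const _)
  unfold clampedLimit
  simp only [hclamp, hval]
  ring

/-- The unit cube of `ℝ^ω × ℝ` can be moved into a hyperplane. -/
theorem exists_homeomorph_cube :
    ∃ Q : (ℕ → ℝ) × ℝ ≃ₜ (ℕ → ℝ) × ℝ, ∀ p, (∀ n, |p.1 n| ≤ 1) → (Q p).2 = 0 := by
  have hc := continuous_clampedLimit
  let Q : (ℕ → ℝ) × ℝ ≃ₜ (ℕ → ℝ) × ℝ :=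
    { toFun := fun p => (fun n => (1 / 2) ^ n * p.1 n + p.2,
        p.2 - clampedLimit fun n => (1 / 2) ^ n * p.1 n + p.2)
      invFun := fun p => (fun n => 2 ^ n * (p.1 n - (p.2 + clampedLimit p.1)),
        p.2 + clampedLimit p.1)
      left_inv := fun p => by
        ext n
        · simp
        · simp
      right_inv := fun p => by
        have h : ∀ n : ℕ, (1 / 2 : ℝ) ^ n * (2 ^ n * (p.1 n - (p.2 + clampedLimit p.1))) +
            (p.2 + clampedLimit p.1) = p.1 n := fun n => by
          rw [← mul_assoc, ← mul_pow]
          norm_num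
        simp only [h]
        ext <;> simp
      continuous_toFun := by fun_prop
      continuous_invFun := by fun_prop }
  exact ⟨Q, fun p hp => sub_eq_zero.2 (clampedLimit_eq hp p.2).symm⟩

/-- A `Z_τ`-set can be moved into the first factor of a square. -/
theorem exists_homeomorph_prod {τ : Cardinal.{u}} (hτ : Cardinal.aleph0 < τ)
    (hA : Cardinal.mk A = τ) {Z : Set (A → ℝ)} (hZ : ZTauSet τ Z) :
    ∃ e : (A → ℝ) ≃ₜ (A → ℝ) × (A → ℝ), ∀ z ∈ Z, (e z).2 = 0 := by
  classical
  obtain ⟨T, E, hE, hTE⟩ := exists_homeomorph_bounded hτ hA hZ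
  obtain ⟨Q, hQ⟩ := exists_homeomorph_cube
  have hmul : Cardinal.mk (A × ℕ) = τ := by
    rw [Cardinal.mk_prod, Cardinal.lift_id'.{0, u}, hA]
    simpa using Cardinal.mul_aleph0_eq hτ.le
  have hmul' : Cardinal.mk (A × ℕ ⊕ A) = τ := by
    rw [Cardinal.mk_sum, Cardinal.lift_id, Cardinal.lift_id, hmul, hA, Cardinal.add_eq_self hτ.le]
  obtain ⟨i⟩ : Nonempty (A × ℕ ⊕ A ≃ E) := Cardinal.eq.1 (hmul'.trans hE.symm)
  obtain ⟨j⟩ : Nonempty (↥Eᶜ ⊕ A × ℕ ≃ A) := Cardinal.eq.1 (by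
    rw [Cardinal.mk_sum, Cardinal.lift_id, Cardinal.lift_id, hmul, hA]
    exact Cardinal.add_eq_right hτ.le ((Cardinal.mk_set_le _).trans hA.le))
  let S : (A → ℝ) ≃ₜ (↥Eᶜ → ℝ) × (A → (ℕ → ℝ) × ℝ) :=
    { toFun := fun y => (fun a => y a,
        fun b => (fun n => y (i (Sum.inl (b, n))), y (i (Sum.inr b))))
      invFun := fun p a => if h : a ∈ E then
          Sum.elim (fun bn => (p.2 bn.1).1 bn.2) (fun b => (p.2 b).2) (i.symm ⟨a, h⟩)
        else p.1 ⟨a, h⟩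
      left_inv := fun y => by
        funext a
        by_cases h : a ∈ E
        · simp only [dif_pos h]
          have hi : (i (i.symm ⟨a, h⟩) : A) = a := by rw [i.apply_symm_apply]
          generalize i.symm ⟨a, h⟩ = s at hi
          rcases s with ⟨b, n⟩ | b <;> simpa using congrArg y hi
        · simp only [dif_neg h]
      right_inv := fun p => by
        refine Prod.ext ?_ ?_
        · funext a
          simp only [dif_neg a.2]
        · funext b
          simp
      continuous_toFun := by fun_prop
      continuous_invFun := continuous_pi fun a => by
        by_cases h : a ∈ E
        · simp only [dif_pos h]
          rcases i.symm ⟨a, h⟩ with ⟨b, n⟩ | b <;> simp only [Sum.elim_inl, Sum.elim_inr] <;>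
            fun_prop
        · simp only [dif_neg h]
          fun_prop }
  let R : (↥Eᶜ → ℝ) × (A → (ℕ → ℝ) × ℝ) ≃ₜ (A → ℝ) × (A → ℝ) :=
    { toFun := fun p => (fun a =>
        Sum.elim p.1 (fun bn : A × ℕ => (p.2 bn.1).1 bn.2) (j.symm a), fun b => (p.2 b).2)
      invFun := fun p => (fun a => p.1 (j (Sum.inl a)),
        fun b => (fun n => p.1 (j (Sum.inr (b, n))), p.2 b))
      left_inv := fun p => by simp
      right_inv := fun p => by
        refine Prod.ext ?_ rfl
        funext a
        obtain ⟨s, rfl⟩ := j.surjective a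
        rcases s with s | s <;> simp
      continuous_toFun := by
        refine .prodMk (continuous_pi fun a => ?_) (by fun_prop)
        rcases j.symm a with s | s <;> simp only [Sum.elim_inl, Sum.elim_inr] <;> fun_prop
      continuous_invFun := by fun_prop }
  refine ⟨((T.trans S).trans ((Homeomorph.refl _).prodCongr
    (Homeomorph.piCongrRight fun _ : A => Q))).trans R, fun z hz => ?_⟩
  funext b
  exact hQ _ fun n => hTE z hz _ (i (Sum.inl (b, n))).2

end RealPower

/-- For closed C-embedded `Z_τ`-sets `Z, F` in `ℝ^τ` (`τ > ω`): `Z` and `F` are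
homeomorphic iff their complements in `ℝ^τ` are homeomorphic. -/
theorem Z_tau_homeomorphic_iff_complements_homeomorphic
    (τ : Cardinal.{u}) (hτ : Cardinal.aleph0 < τ)
    (A : Type u) (hA : Cardinal.mk A = τ)
    (Z F : Set (A → ℝ)) (hZcl : IsClosed Z) (hFcl : IsClosed F)
    (hZ : ZTauSet τ Z) (hF : ZTauSet τ F)
    (hZC : CEmbedded Z) (hFC : CEmbedded F) :
    Nonempty (↥Z ≃ₜ ↥F) ↔ Nonempty (↥(Zᶜ) ≃ₜ ↥(Fᶜ)) := by
  refine ⟨fun ⟨h⟩ => ?_, fun ⟨u⟩ => RealPower.nonempty_homeomorph_of_compl hτ hZ hF u⟩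
  obtain ⟨eZ, heZ⟩ := RealPower.exists_homeomorph_prod hτ hA hZ
  obtain ⟨eF, heF⟩ := RealPower.exists_homeomorph_prod hτ hA hF
  obtain ⟨T, hT⟩ := RealPower.exists_homeomorph_extension hZC hFC eZ eF heZ heF h
  refine ⟨T.sets ?_⟩
  have hZF : Z = T ⁻¹' F := by
    ext x
    refine ⟨fun hx => mem_preimage.2 ((hT ⟨x, hx⟩).symm ▸ (h ⟨x, hx⟩).2), fun hx => ?_⟩
    have hx' := hT (h.symm ⟨T x, hx⟩)
    rw [h.apply_symm_apply] at hx'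
    exact T.injective hx' ▸ (h.symm ⟨T x, hx⟩).2
  rw [preimage_compl, ← hZF]
end
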